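/- (Global Lipschitz bound.) Let n ≥ 2 and let (u,v) be a solution of Δu = u v², Δv = v u², u > 0, v > 0 on ℝⁿ satisfying the linear growth condition u(x) + v(x) ≤ C₀(1 + |x|) for some constant C₀ > 0. Then there exists a constant C > 0 such that sup_{ℝⁿ} ( |∇u| + |∇v| ) ≤ C. -/

import Mathlib

open MeasureTheory Metric
open scoped RealInnerProductSpace

noncomputable section

/-- The Laplacian of a function on Euclidean space, as the trace of the second derivative. -/
def lap {n : ℕ} (u : EuclideanSpace ℝ (Fin n) → ℝ) (x : EuclideanSpace ℝ (Fin n)) : ℝ :=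
  ∑ i : Fin n, iteratedFDeriv ℝ 2 u x (fun _ => EuclideanSpace.single i 1)

/-- A (positive classical) solution of the system Δu = u v², Δv = v u², u,v > 0 on ℝⁿ. -/
def IsSolution {n : ℕ} (u v : EuclideanSpace ℝ (Fin n) → ℝ) : Prop :=
  ContDiff ℝ (⊤ : ℕ∞) u ∧ ContDiff ℝ (⊤ : ℕ∞) v ∧ (∀ x, 0 < u x) ∧ (∀ x, 0 < v x) ∧
    (∀ x, lap u x = u x * v x ^ 2) ∧ (∀ x, lap v x = v x * u x ^ 2)

open Filter Topology

/-- `g` is twice differentiable at `0` with first derivative `a` and second derivative `b`. -/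
def HasJet (g : ℝ → ℝ) (a b : ℝ) : Prop :=
  ∃ g' : ℝ → ℝ, (∀ᶠ t in 𝓝 0, HasDerivAt g (g' t) t) ∧ g' 0 = a ∧ HasDerivAt g' b 0

namespace HasJet

variable {f g : ℝ → ℝ} {a b c d : ℝ}

theorem hasDerivAt (h : HasJet g a b) : HasDerivAt g a 0 := by
  obtain ⟨g', h1, rfl, -⟩ := h
  exact h1.self_of_nhds

theorem congr (h : HasJet g a b) (hfg : f =ᶠ[𝓝 0] g) : HasJet f a b := by
  obtain ⟨g', h1, h2, h3⟩ := h
  refine ⟨g', ?_, h2, h3⟩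
  filter_upwards [h1, hfg.eventuallyEq_nhds] with t ht ht'
  exact ht.congr_of_eventuallyEq ht'

theorem add (hf : HasJet f a b) (hg : HasJet g c d) :
    HasJet (fun t => f t + g t) (a + c) (b + d) := by
  obtain ⟨f', h1, rfl, h3⟩ := hf
  obtain ⟨g', k1, rfl, k3⟩ := hg
  refine ⟨fun t => f' t + g' t, ?_, rfl, h3.fun_add k3⟩
  filter_upwards [h1, k1] with t ht ht'
  exact ht.fun_add ht'

theorem neg (hf : HasJet f a b) : HasJet (fun t => -f t) (-a) (-b) := by
  obtain ⟨f', h1, rfl, h3⟩ := hf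
  refine ⟨fun t => -f' t, ?_, rfl, h3.fun_neg⟩
  filter_upwards [h1] with t ht
  exact ht.fun_neg

theorem sub (hf : HasJet f a b) (hg : HasJet g c d) :
    HasJet (fun t => f t - g t) (a - c) (b - d) := by
  simpa only [sub_eq_add_neg] using hf.add hg.neg

theorem comp {H H' : ℝ → ℝ} {h₂ : ℝ} (hg : HasJet g a b)
    (hH : ∀ᶠ s in 𝓝 (g 0), HasDerivAt H (H' s) s) (hH' : HasDerivAt H' h₂ (g 0)) :
    HasJet (fun t => H (g t)) (H' (g 0) * a) (h₂ * a ^ 2 + H' (g 0) * b) := by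
  have hd := hg.hasDerivAt
  obtain ⟨g', h1, rfl, h3⟩ := hg
  refine ⟨fun t => H' (g t) * g' t, ?_, rfl, ?_⟩
  · filter_upwards [h1, hd.continuousAt.eventually hH] with t ht ht'
    exact ht'.comp t ht
  · have := (hH'.comp (0 : ℝ) hd).fun_mul h3
    refine this.congr_deriv ?_
    simp only [Function.comp]
    ring

theorem quadratic (c₀ c₁ c₂ : ℝ) :
    HasJet (fun t => c₀ + c₁ * t + c₂ * t ^ 2) c₁ (2 * c₂) := by
  refine ⟨fun t => c₁ + 2 * c₂ * t, .of_forall fun t => ?_, by simp, ?_⟩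
  · have := (((hasDerivAt_id t).const_mul c₁).const_add c₀).fun_add
      (((hasDerivAt_id t).fun_pow 2).const_mul c₂)
    refine this.congr_deriv ?_
    simp
    ring
  · have := ((hasDerivAt_id (0 : ℝ)).const_mul (2 * c₂)).const_add c₁
    simpa using this

theorem unique (h : HasJet g a b) (k : HasJet g c d) : a = c ∧ b = d := by
  refine ⟨h.hasDerivAt.unique k.hasDerivAt, ?_⟩
  obtain ⟨f', h1, -, h3⟩ := h
  obtain ⟨g', k1, -, k3⟩ := k
  refine h3.unique (k3.congr_of_eventuallyEq ?_)
  filter_upwards [h1, k1] with t ht ht' using ht.unique ht'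

theorem eq_zero_of_isLocalMax (h : HasJet g a b) (hm : IsLocalMax g 0) : a = 0 :=
  hm.hasDerivAt_eq_zero h.hasDerivAt

theorem nonpos_of_isLocalMax (h : HasJet g a b) (hm : IsLocalMax g 0) : b ≤ 0 := by
  by_contra! hb
  have ha := h.eq_zero_of_isLocalMax hm
  subst ha
  have hd := h.hasDerivAt
  have hmin : IsLocalMin g 0 := by
    obtain ⟨g', h1, -, h3⟩ := h
    have hE : deriv g =ᶠ[𝓝 0] g' := h1.mono fun t ht => ht.deriv
    exact isLocalMin_of_deriv_deriv_pos (by rwa [hE.deriv_eq, h3.deriv]) hd.deriv hd.continuousAt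
  have hc : g =ᶠ[𝓝 0] fun t => g 0 + 0 * t + 0 * t ^ 2 := by
    filter_upwards [hm, hmin] with t h1 h2
    simp only [zero_mul, add_zero]
    exact le_antisymm h1 h2
  have := (h.unique ((quadratic (g 0) 0 0).congr hc)).2
  linarith

end HasJet

section Lines

variable {n : ℕ} {f g : EuclideanSpace ℝ (Fin n) → ℝ}

theorem hasJet_line (hf : ContDiff ℝ 2 f) (x a : EuclideanSpace ℝ (Fin n)) :
    HasJet (fun t : ℝ => f (x + t • a)) (fderiv ℝ f x a) (fderiv ℝ (fderiv ℝ f) x a a) := by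
  have hline (t : ℝ) : HasDerivAt (fun t : ℝ => x + t • a) a t := by
    simpa using ((hasDerivAt_id t).smul_const a).const_add x
  have h1 : Differentiable ℝ f := hf.differentiable (by norm_num)
  have h2 : Differentiable ℝ (fderiv ℝ f) :=
    (hf.fderiv_right (m := 1) (by norm_num)).differentiable (by norm_num)
  refine ⟨fun t => fderiv ℝ f (x + t • a) a, .of_forall fun t => ?_, by simp, ?_⟩
  · exact (h1 (x + t • a)).hasFDerivAt.comp_hasDerivAt t (hline t)
  · have h3 := (h2 (x + (0 : ℝ) • a)).hasFDerivAt.comp_hasDerivAt (0 : ℝ) (hline 0)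
    have h4 := h3.clm_apply (hasDerivAt_const (0 : ℝ) a)
    simpa using h4

theorem lap_eq_sum (b : OrthonormalBasis (Fin n) ℝ (EuclideanSpace ℝ (Fin n)))
    (x : EuclideanSpace ℝ (Fin n)) :
    lap f x = ∑ i, fderiv ℝ (fderiv ℝ f) x (b i) (b i) := by
  have h1 := congrFun (InnerProductSpace.laplacian_eq_iteratedFDeriv_orthonormalBasis f b) x
  have h2 := congrFun (InnerProductSpace.laplacian_eq_iteratedFDeriv_orthonormalBasis f
    (EuclideanSpace.basisFun (Fin n) ℝ)) x
  rw [h1] at h2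
  simp only [iteratedFDeriv_two_apply] at h2
  simp only [lap, iteratedFDeriv_two_apply]
  simpa using h2.symm

theorem lap_eq_of_hasJet (hf : ContDiff ℝ 2 f)
    (b : OrthonormalBasis (Fin n) ℝ (EuclideanSpace ℝ (Fin n)))
    {x : EuclideanSpace ℝ (Fin n)} {c d : Fin n → ℝ}
    (h : ∀ i, HasJet (fun t : ℝ => f (x + t • b i)) (c i) (d i)) : lap f x = ∑ i, d i := by
  rw [lap_eq_sum b]
  exact Finset.sum_congr rfl fun i _ => ((hasJet_line hf x (b i)).unique (h i)).2

theorem lap_neg (hf : ContDiff ℝ 2 f) (x : EuclideanSpace ℝ (Fin n)) :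
    lap (fun y => -f y) x = -lap f x := by
  let b := EuclideanSpace.basisFun (Fin n) ℝ
  rw [lap_eq_of_hasJet hf.neg b fun i => (hasJet_line hf x (b i)).neg, lap_eq_sum b]
  simp

theorem lap_sub (hf : ContDiff ℝ 2 f) (hg : ContDiff ℝ 2 g) (x : EuclideanSpace ℝ (Fin n)) :
    lap (fun y => f y - g y) x = lap f x - lap g x := by
  let b := EuclideanSpace.basisFun (Fin n) ℝ
  rw [lap_eq_of_hasJet (hf.sub hg) b
    fun i => (hasJet_line hf x (b i)).sub (hasJet_line hg x (b i)), lap_eq_sum b, lap_eq_sum b]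
  simp

theorem lap_log (hf : ContDiff ℝ 2 f) (hpos : ∀ x, 0 < f x)
    (b : OrthonormalBasis (Fin n) ℝ (EuclideanSpace ℝ (Fin n))) (x : EuclideanSpace ℝ (Fin n)) :
    lap (fun y => Real.log (f y)) x =
      lap f x / f x - ∑ i, (fderiv ℝ (fun y => Real.log (f y)) x (b i)) ^ 2 := by
  have hl : ContDiff ℝ 2 fun y => Real.log (f y) := hf.log fun x => (hpos x).ne'
  have hj (i) := (hasJet_line hf x (b i)).comp (H := Real.log) (H' := fun s => s⁻¹)
    (h₂ := -(f x ^ 2)⁻¹)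
    (by
      filter_upwards [lt_mem_nhds (hpos _)] with s hs using Real.hasDerivAt_log hs.ne')
    (by simpa using hasDerivAt_inv (hpos x).ne')
  rw [lap_eq_of_hasJet hl b hj, lap_eq_sum b, Finset.sum_div, ← Finset.sum_sub_distrib]
  refine Finset.sum_congr rfl fun i _ => ?_
  rw [((hasJet_line hl x (b i)).unique (hj i)).1]
  have := (hpos x).ne'
  simp
  field_simp
  ring

end Lines

section Doubling

variable {n : ℕ} {f g : EuclideanSpace ℝ (Fin n) → ℝ} {a S T K r : ℝ}
  {p x y e : EuclideanSpace ℝ (Fin n)}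

/-- The two-point barrier: a concave function of the distance plus a localization of the
midpoint. -/
def barrier (a S T K : ℝ) (p x y : EuclideanSpace ℝ (Fin n)) : ℝ :=
  a + S * ‖x - y‖ - T * ‖x - y‖ ^ 2 + K * ‖(1 / 2 : ℝ) • (x + y) - p‖ ^ 2

theorem continuous_barrier (a S T K : ℝ) (p : EuclideanSpace ℝ (Fin n)) :
    Continuous fun z : EuclideanSpace ℝ (Fin n) × EuclideanSpace ℝ (Fin n) =>
      barrier a S T K p z.1 z.2 := by
  unfold barrier
  fun_prop

theorem IsLocalMax.comp_line {G : EuclideanSpace ℝ (Fin n) × EuclideanSpace ℝ (Fin n) → ℝ}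
    (h : IsLocalMax G (x, y)) (α β : EuclideanSpace ℝ (Fin n)) :
    IsLocalMax (fun t : ℝ => G (x + t • α, y + t • β)) 0 := by
  have hc : ContinuousAt (fun t : ℝ => (x + t • α, y + t • β)) 0 := by fun_prop
  have h' : IsLocalMax G ((fun t : ℝ => (x + t • α, y + t • β)) 0) := by simpa using h
  exact hc.tendsto.eventually h'

theorem norm_add_smul_sq (q w : EuclideanSpace ℝ (Fin n)) (t : ℝ) :
    ‖q + t • w‖ ^ 2 = ‖q‖ ^ 2 + 2 * ⟪q, w⟫ * t + ‖w‖ ^ 2 * t ^ 2 := by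
  rw [norm_add_sq_real, inner_smul_right, norm_smul, mul_pow, Real.norm_eq_abs, sq_abs]
  ring

theorem sum_sq_inner (b : OrthonormalBasis (Fin n) ℝ (EuclideanSpace ℝ (Fin n)))
    (q : EuclideanSpace ℝ (Fin n)) : ∑ i, ⟪q, b i⟫ ^ 2 = ‖q‖ ^ 2 := by
  rw [← real_inner_self_eq_norm_sq, ← b.sum_inner_mul_inner q q]
  exact Finset.sum_congr rfl fun i _ => by rw [sq, real_inner_comm q (b i)]

theorem sum_inner_mul (b : OrthonormalBasis (Fin n) ℝ (EuclideanSpace ℝ (Fin n)))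
    (q e : EuclideanSpace ℝ (Fin n)) : ∑ i, ⟪q, b i⟫ * ⟪e, b i⟫ = ⟪q, e⟫ := by
  rw [← b.sum_inner_mul_inner q e]
  exact Finset.sum_congr rfl fun i _ => by rw [real_inner_comm e (b i)]

/-- The barrier along a line moved by reflection through the hyperplane orthogonal to `x - y`. -/
theorem hasJet_barrier_reflection (he : ‖e‖ = 1) (hr : 0 < r) (hxy : x - y = r • e)
    (θ : EuclideanSpace ℝ (Fin n)) :
    HasJet (fun t : ℝ => barrier a S T K p (x + t • θ) (y + t • (θ - (2 * ⟪e, θ⟫) • e)))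
      (2 * ((S - 2 * T * r) * ⟪e, θ⟫ +
        K * ⟪(1 / 2 : ℝ) • (x + y) - p, θ - ⟪e, θ⟫ • e⟫))
      (2 * (-4 * T * ⟪e, θ⟫ ^ 2 + K * (‖θ‖ ^ 2 - ⟪e, θ⟫ ^ 2))) := by
  set β := ⟪e, θ⟫ with hβ
  set q := (1 / 2 : ℝ) • (x + y) - p with hq
  have hw : ‖θ - β • e‖ ^ 2 = ‖θ‖ ^ 2 - β ^ 2 := by
    rw [norm_sub_sq_real, inner_smul_right, norm_smul, he, real_inner_comm, ← hβ, mul_one,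
      Real.norm_eq_abs, sq_abs]
    ring
  refine HasJet.congr (g := fun t => barrier a S T K p x y
    + (2 * ((S - 2 * T * r) * β + K * ⟪q, θ - β • e⟫)) * t +
    (-4 * T * β ^ 2 + K * (‖θ‖ ^ 2 - β ^ 2)) * t ^ 2) (HasJet.quadratic _ _ _) ?_
  have hpos : ∀ᶠ t : ℝ in 𝓝 0, 0 < r + 2 * β * t := by
    have : ContinuousAt (fun t : ℝ => r + 2 * β * t) 0 := by fun_prop
    exact this.eventually (lt_mem_nhds (by simpa using hr))
  filter_upwards [hpos] with t ht
  have h1 : ‖x + t • θ - (y + t • (θ - (2 * β) • e))‖ = r + 2 * β * t := by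
    have : x + t • θ - (y + t • (θ - (2 * β) • e)) = (r + 2 * β * t) • e := by
      rw [add_smul, ← hxy]
      module
    rw [this, norm_smul, he, mul_one, Real.norm_of_nonneg ht.le]
  have h2 : (1 / 2 : ℝ) • (x + t • θ + (y + t • (θ - (2 * β) • e))) - p
      = q + t • (θ - β • e) := by
    rw [hq]
    module
  have h3 : ‖x - y‖ = r := by rw [hxy, norm_smul, he, mul_one, Real.norm_of_nonneg hr.le]
  rw [barrier, h1, h2, norm_add_smul_sq, hw, barrier, h3, ← hq]
  ring

/-- The coupling by reflection: second order condition at a maximum of the doubled function. -/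
theorem lap_add_lap_le_of_isLocalMax (hf : ContDiff ℝ 2 f) (hg : ContDiff ℝ 2 g)
    (he : ‖e‖ = 1) (hr : 0 < r) (hxy : x - y = r • e) {H H' : ℝ → ℝ} {h₂ : ℝ}
    (hH : ∀ᶠ s in 𝓝 (barrier a S T K p x y), HasDerivAt H (H' s) s)
    (hH' : HasDerivAt H' h₂ (barrier a S T K p x y))
    (hm : IsLocalMax (fun z : EuclideanSpace ℝ (Fin n) × EuclideanSpace ℝ (Fin n) =>
      f z.1 + g z.2 - H (barrier a S T K p z.1 z.2)) (x, y)) :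
    lap f x + lap g y ≤ H' (barrier a S T K p x y) * (-8 * T + 2 * K * (n - 1)) +
      h₂ * (4 * (S - 2 * T * r) ^ 2 + 4 * K ^ 2 * (‖(1 / 2 : ℝ) • (x + y) - p‖ ^ 2 -
        ⟪(1 / 2 : ℝ) • (x + y) - p, e⟫ ^ 2)) := by
  set ψ₀ := barrier a S T K p x y with hψ₀
  set q := (1 / 2 : ℝ) • (x + y) - p with hq
  set σ := S - 2 * T * r with hσ
  let b := EuclideanSpace.basisFun (Fin n) ℝ
  let M : EuclideanSpace ℝ (Fin n) ≃ₗᵢ[ℝ] EuclideanSpace ℝ (Fin n) :=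
    (Submodule.span ℝ {e})ᗮ.reflection
  have hM (θ : EuclideanSpace ℝ (Fin n)) : M θ = θ - (2 * ⟪e, θ⟫) • e := by
    simp only [M, Submodule.reflection_orthogonal_apply, Submodule.reflection_singleton_apply, he]
    simp
    module
  have key (i : Fin n) : fderiv ℝ (fderiv ℝ f) x (b i) (b i) +
      fderiv ℝ (fderiv ℝ g) y (b.map M i) (b.map M i) ≤
      h₂ * (2 * (σ * ⟪e, b i⟫ + K * (⟪q, b i⟫ - ⟪e, b i⟫ * ⟪q, e⟫))) ^ 2 +
        H' ψ₀ * (2 * (-4 * T * ⟪e, b i⟫ ^ 2 + K * (1 - ⟪e, b i⟫ ^ 2))) := by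
    have hj := hasJet_barrier_reflection (a := a) (S := S) (T := T) (K := K) (p := p) he hr hxy
      (b i)
    have hj' := hj.comp (H := H) (H' := H') (h₂ := h₂) (by simpa using hH) (by simpa using hH')
    have hj2 := ((hasJet_line hf x (b i)).add (hasJet_line hg y (b.map M i))).sub hj'
    have hmax := hm.comp_line (b i) (b.map M i)
    have hMb : b.map M i = b i - (2 * ⟪e, b i⟫) • e := by
      rw [OrthonormalBasis.map_apply, hM]
    rw [hMb] at hmax hj2 ⊢
    have := hj2.nonpos_of_isLocalMax hmax
    simp only [zero_smul, add_zero, b.norm_eq_one, one_pow] at this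
    rw [inner_sub_right, inner_smul_right, ← hq, ← hψ₀, ← hσ] at this
    linarith
  rw [lap_eq_sum b, lap_eq_sum (b.map M), ← Finset.sum_add_distrib]
  refine (Finset.sum_le_sum fun i _ => key i).trans (le_of_eq ?_)
  have s1 : ∑ i, ⟪e, b i⟫ ^ 2 = 1 := by rw [sum_sq_inner b, he, one_pow]
  have s2 := sum_sq_inner b q
  have s3 := sum_inner_mul b q e
  have expand (i : Fin n) :
      h₂ * (2 * (σ * ⟪e, b i⟫ + K * (⟪q, b i⟫ - ⟪e, b i⟫ * ⟪q, e⟫))) ^ 2 +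
        H' ψ₀ * (2 * (-4 * T * ⟪e, b i⟫ ^ 2 + K * (1 - ⟪e, b i⟫ ^ 2))) =
      (4 * h₂ * (σ - K * ⟪q, e⟫) ^ 2 + H' ψ₀ * (2 * (-4 * T - K))) * ⟪e, b i⟫ ^ 2 +
      4 * h₂ * K ^ 2 * ⟪q, b i⟫ ^ 2 +
      8 * h₂ * (σ - K * ⟪q, e⟫) * K * (⟪q, b i⟫ * ⟪e, b i⟫) + H' ψ₀ * 2 * K := by ring
  simp only [expand, Finset.sum_add_distrib, ← Finset.mul_sum, s1, s2, s3]
  simp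
  ring

theorem hasDerivAt_barrier (he : ‖e‖ = 1) (hr : 0 < r) (hxy : x - y = r • e)
    (α β : EuclideanSpace ℝ (Fin n)) :
    HasDerivAt (fun t : ℝ => barrier a S T K p (x + t • α) (y + t • β))
      ((S - 2 * T * r) * ⟪e, α - β⟫ + K * ⟪(1 / 2 : ℝ) • (x + y) - p, α + β⟫) 0 := by
  set q := (1 / 2 : ℝ) • (x + y) - p with hq
  have hquad (c₀ c₁ c₂ : ℝ) : HasDerivAt (fun t : ℝ => c₀ + c₁ * t + c₂ * t ^ 2) c₁ 0 :=
    (HasJet.quadratic c₀ c₁ c₂).hasDerivAt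
  have h3 : ‖x - y‖ = r := by rw [hxy, norm_smul, he, mul_one, Real.norm_of_nonneg hr.le]
  have h1 : (fun t : ℝ => barrier a S T K p (x + t • α) (y + t • β)) = fun t =>
      a + S * Real.sqrt (r ^ 2 + 2 * ⟪x - y, α - β⟫ * t + ‖α - β‖ ^ 2 * t ^ 2)
        - T * (r ^ 2 + 2 * ⟪x - y, α - β⟫ * t + ‖α - β‖ ^ 2 * t ^ 2)
        + K * (‖q‖ ^ 2 + ⟪q, α + β⟫ * t + ‖(1 / 2 : ℝ) • (α + β)‖ ^ 2 * t ^ 2) := by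
    ext t
    have e1 : x + t • α - (y + t • β) = (x - y) + t • (α - β) := by module
    have e2 : (1 / 2 : ℝ) • (x + t • α + (y + t • β)) - p = q + t • ((1 / 2 : ℝ) • (α + β)) := by
      rw [hq]
      module
    rw [barrier, e1, e2, ← h3, ← norm_add_smul_sq, Real.sqrt_sq (norm_nonneg _),
      norm_add_smul_sq q, inner_smul_right]
    ring
  rw [h1]
  have d1 := hquad (r ^ 2) (2 * ⟪x - y, α - β⟫) (‖α - β‖ ^ 2)
  have d2 := d1.sqrt (by simpa using hr.ne')
  have d3 := hquad (‖q‖ ^ 2) ⟪q, α + β⟫ (‖(1 / 2 : ℝ) • (α + β)‖ ^ 2)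
  refine ((((d2.const_mul S).const_add a).fun_sub (d1.const_mul T)).fun_add
    (d3.const_mul K)).congr_deriv ?_
  simp only [mul_zero, add_zero, ne_eq, OfNat.ofNat_ne_zero, not_false_eq_true, zero_pow,
    Real.sqrt_sq hr.le]
  rw [hxy, real_inner_smul_left]
  field_simp

/-- The first order conditions at a maximum of the doubled function. -/
theorem fderiv_eq_of_isLocalMax (hf : ContDiff ℝ 2 f) (hg : ContDiff ℝ 2 g)
    (he : ‖e‖ = 1) (hr : 0 < r) (hxy : x - y = r • e) {H : ℝ → ℝ} {h₁ : ℝ}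
    (hH : HasDerivAt H h₁ (barrier a S T K p x y))
    (hm : IsLocalMax (fun z : EuclideanSpace ℝ (Fin n) × EuclideanSpace ℝ (Fin n) =>
      f z.1 + g z.2 - H (barrier a S T K p z.1 z.2)) (x, y)) (θ : EuclideanSpace ℝ (Fin n)) :
    fderiv ℝ f x θ =
      h₁ * ((S - 2 * T * r) * ⟪e, θ⟫ + K * ⟪(1 / 2 : ℝ) • (x + y) - p, θ⟫) ∧
    fderiv ℝ g y θ =
      h₁ * (-(S - 2 * T * r) * ⟪e, θ⟫ + K * ⟪(1 / 2 : ℝ) • (x + y) - p, θ⟫) := by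
  have key (α β : EuclideanSpace ℝ (Fin n)) := (hm.comp_line α β).hasDerivAt_eq_zero
    (((hasJet_line hf x α).hasDerivAt.add (hasJet_line hg y β).hasDerivAt).sub
      (HasDerivAt.comp (0 : ℝ) (h₂ := H) (by simpa using hH)
        (hasDerivAt_barrier (a := a) (S := S) (T := T) (K := K) (p := p) he hr hxy α β)))
  constructor
  · have := key θ 0
    simp only [map_zero, sub_zero, add_zero] at this
    linarith
  · have := key 0 θ
    simp only [map_zero, zero_sub, zero_add, inner_neg_right] at this
    linarith

theorem le_zero_of_no_interior_max
    {G : EuclideanSpace ℝ (Fin n) × EuclideanSpace ℝ (Fin n) → ℝ} {d ρ : ℝ}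
    (hG : ContinuousOn G {z | ‖z.1 - z.2‖ ≤ d ∧ ‖(1 / 2 : ℝ) • (z.1 + z.2) - p‖ ≤ ρ})
    (hd : ∀ x y, ‖x - y‖ = d → ‖(1 / 2 : ℝ) • (x + y) - p‖ ≤ ρ → G (x, y) ≤ 0)
    (hρ : ∀ x y, ‖x - y‖ ≤ d → ‖(1 / 2 : ℝ) • (x + y) - p‖ = ρ → G (x, y) ≤ 0)
    (hint : ∀ x y, ‖x - y‖ < d → ‖(1 / 2 : ℝ) • (x + y) - p‖ < ρ → 0 < G (x, y) →
      IsLocalMax G (x, y) → False)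
    (hx : ‖x - y‖ ≤ d) (hy : ‖(1 / 2 : ℝ) • (x + y) - p‖ ≤ ρ) : G (x, y) ≤ 0 := by
  set D : Set (EuclideanSpace ℝ (Fin n) × EuclideanSpace ℝ (Fin n)) :=
    {z | ‖z.1 - z.2‖ ≤ d ∧ ‖(1 / 2 : ℝ) • (z.1 + z.2) - p‖ ≤ ρ} with hD
  have c1 : Continuous fun z : EuclideanSpace ℝ (Fin n) × EuclideanSpace ℝ (Fin n) =>
      ‖z.1 - z.2‖ := by fun_prop
  have c2 : Continuous fun z : EuclideanSpace ℝ (Fin n) × EuclideanSpace ℝ (Fin n) =>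
      ‖(1 / 2 : ℝ) • (z.1 + z.2) - p‖ := by fun_prop
  have hclosed : IsClosed D :=
    (isClosed_le c1 continuous_const).inter (isClosed_le c2 continuous_const)
  have hbdd : D ⊆ closedBall (0 : EuclideanSpace ℝ (Fin n) × EuclideanSpace ℝ (Fin n))
      (ρ + ‖p‖ + d) := by
    rintro ⟨z, w⟩ ⟨h1, h2⟩
    simp only at h1 h2
    have hd0 : 0 ≤ d := (norm_nonneg _).trans h1
    have e1 : z = ((1 / 2 : ℝ) • (z + w) - p) + p + (1 / 2 : ℝ) • (z - w) := by module
    have e2 : w = ((1 / 2 : ℝ) • (z + w) - p) + p + (-(1 / 2) : ℝ) • (z - w) := by module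
    have e3 (c : ℝ) (hc : |c| ≤ 1) :
        ‖((1 / 2 : ℝ) • (z + w) - p) + p + c • (z - w)‖ ≤ ρ + ‖p‖ + d := by
      refine (norm_add₃_le).trans ?_
      rw [norm_smul, Real.norm_eq_abs]
      nlinarith [norm_nonneg (z - w), abs_nonneg c]
    rw [mem_closedBall_zero_iff, Prod.norm_mk, sup_le_iff]
    refine ⟨?_, ?_⟩
    · rw [e1]; exact e3 _ (by norm_num [abs_of_pos])
    · rw [e2]; exact e3 _ (by norm_num [abs_of_pos])
  have hcomp : IsCompact D := (isCompact_closedBall _ _).of_isClosed_subset hclosed hbdd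
  have hmem : (x, y) ∈ D := ⟨hx, hy⟩
  obtain ⟨⟨x', y'⟩, ⟨h1, h2⟩, hmax⟩ := hcomp.exists_isMaxOn ⟨_, hmem⟩ hG
  refine (hmax hmem).trans ?_
  by_contra! hpos
  rcases h1.lt_or_eq with h1 | h1
  · rcases h2.lt_or_eq with h2 | h2
    · refine hint x' y' h1 h2 hpos (hmax.isLocalMax ?_)
      have o : IsOpen {z : EuclideanSpace ℝ (Fin n) × EuclideanSpace ℝ (Fin n) |
          ‖z.1 - z.2‖ < d ∧ ‖(1 / 2 : ℝ) • (z.1 + z.2) - p‖ < ρ} :=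
        (isOpen_lt c1 continuous_const).inter (isOpen_lt c2 continuous_const)
      exact mem_of_superset (o.mem_nhds ⟨h1, h2⟩) fun z hz => ⟨hz.1.le, hz.2.le⟩
    · exact hpos.not_ge (hρ _ _ h1.le h2)
  · exact hpos.not_ge (hd _ _ h1 h2)

end Doubling

section GradientEstimate

variable {n : ℕ} {f g : EuclideanSpace ℝ (Fin n) → ℝ} {a S T K : ℝ}
  {p x y : EuclideanSpace ℝ (Fin n)}

theorem exists_unit_direction (h : x ≠ y) :
    ∃ e : EuclideanSpace ℝ (Fin n), ‖e‖ = 1 ∧ x - y = ‖x - y‖ • e := by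
  have h0 : ‖x - y‖ ≠ 0 := norm_ne_zero_iff.2 (sub_ne_zero.2 h)
  refine ⟨‖x - y‖⁻¹ • (x - y), ?_, ?_⟩
  · rw [norm_smul, norm_inv, norm_norm, inv_mul_cancel₀ h0]
  · rw [smul_smul, mul_inv_cancel₀ h0, one_smul]

theorem mem_closedBall_of_midpoint {d ρ R : ℝ} (hx : ‖x - y‖ ≤ d)
    (hq : ‖(1 / 2 : ℝ) • (x + y) - p‖ ≤ ρ) (hR : ρ + d / 2 ≤ R) :
    x ∈ closedBall p R ∧ y ∈ closedBall p R := by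
  have e1 : x - p = ((1 / 2 : ℝ) • (x + y) - p) + (1 / 2 : ℝ) • (x - y) := by module
  have e2 : y - p = ((1 / 2 : ℝ) • (x + y) - p) + (-(1 / 2) : ℝ) • (x - y) := by module
  have e3 (c : ℝ) (hc : |c| = 1 / 2) :
      ‖((1 / 2 : ℝ) • (x + y) - p) + c • (x - y)‖ ≤ R := by
    refine (norm_add_le _ _).trans ?_
    rw [norm_smul, Real.norm_eq_abs, hc]
    linarith
  rw [mem_closedBall, mem_closedBall, dist_eq_norm, dist_eq_norm, e1, e2]
  exact ⟨e3 _ (by norm_num [abs_of_pos]), e3 _ (by norm_num [abs_of_pos])⟩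

theorem le_barrier {R : ℝ} (hR : 0 < R) (hS : 0 ≤ S) (h : ‖x - y‖ ≤ R) :
    a + S / 2 * ‖x - y‖ + K * ‖(1 / 2 : ℝ) • (x + y) - p‖ ^ 2 ≤
      barrier a S (S / (2 * R)) K p x y := by
  have : S / (2 * R) * ‖x - y‖ ^ 2 ≤ S / 2 * ‖x - y‖ := by
    have h1 : S / (2 * R) * ‖x - y‖ ^ 2 = S / 2 * ‖x - y‖ * (‖x - y‖ / R) := by
      field_simp
    rw [h1]
    exact mul_le_of_le_one_right (by positivity) ((div_le_one hR).2 h)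
  rw [barrier]
  linarith

theorem barrier_midpoint_le (hT : 0 ≤ T) :
    barrier a S T K ((1 / 2 : ℝ) • (x + y)) x y ≤ a + S * ‖x - y‖ := by
  have : 0 ≤ T * ‖x - y‖ ^ 2 := by positivity
  rw [barrier, sub_self]
  simp
  linarith

theorem lap_add_lap_le (hf : ContDiff ℝ 2 f) (hg : ContDiff ℝ 2 g) (hxy : x ≠ y)
    (hm : IsLocalMax (fun z : EuclideanSpace ℝ (Fin n) × EuclideanSpace ℝ (Fin n) =>
      f z.1 + g z.2 - barrier a S T K p z.1 z.2) (x, y)) :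
    lap f x + lap g y ≤ -8 * T + 2 * K * (n - 1) := by
  obtain ⟨e, he, hxe⟩ := exists_unit_direction hxy
  have := lap_add_lap_le_of_isLocalMax (H := fun s => s) (H' := fun _ => 1) (h₂ := 0) hf hg he
    (norm_pos_iff.2 (sub_ne_zero.2 hxy)) hxe (.of_forall fun s => hasDerivAt_id s)
    (hasDerivAt_const _ _) hm
  linarith

theorem HasDerivAt.le_of_eventually_le {φ : ℝ → ℝ} {c M : ℝ} (h : HasDerivAt φ c 0)
    (hφ : ∀ᶠ t in 𝓝[>] 0, φ t - φ 0 ≤ M * t) : c ≤ M := by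
  refine le_of_tendsto h.tendsto_slope_zero_right ?_
  filter_upwards [hφ, self_mem_nhdsWithin] with t ht ht'
  rw [zero_add, smul_eq_mul, inv_mul_le_iff₀ ht', mul_comm]
  exact ht

theorem ContinuousLinearMap.norm_le_of_forall_le
    {L : EuclideanSpace ℝ (Fin n) →L[ℝ] ℝ} {M : ℝ} (hM : 0 ≤ M) (h : ∀ θ, L θ ≤ M * ‖θ‖) :
    ‖L‖ ≤ M := by
  refine L.opNorm_le_bound hM fun θ => ?_
  rw [Real.norm_eq_abs, abs_le]
  have := h (-θ)
  rw [map_neg, norm_neg] at this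
  exact ⟨by linarith, h θ⟩

/-- Interior gradient estimate. -/
theorem norm_fderiv_le (hn : 1 ≤ n) (hf : ContDiff ℝ 2 f) {d A B : ℝ} (hd : 0 < d) (hA : 0 < A)
    (hosc : ∀ x ∈ closedBall p d, ∀ y ∈ closedBall p d, f x - f y ≤ A)
    (h0 : ∀ x ∈ closedBall p d, 0 ≤ lap f x) (hB : ∀ x ∈ closedBall p d, lap f x ≤ B) :
    ‖fderiv ℝ f p‖ ≤ 2 * n * A / d + B * d := by
  have hp : p ∈ closedBall p d := mem_closedBall_self hd.le
  have hB0 : 0 ≤ B := (h0 p hp).trans (hB p hp)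
  have hn' : (1 : ℝ) ≤ n := by exact_mod_cast hn
  set S := 2 * n * A / d + B * d with hS
  have hS0 : 0 ≤ S := by positivity
  have hSd : S * d = 2 * n * A + B * d ^ 2 := by rw [hS]; field_simp
  have hnA : A ≤ n * A := le_mul_of_one_le_left hA.le hn'
  have key {x y : EuclideanSpace ℝ (Fin n)} (hx : ‖x - y‖ ≤ d)
      (hq : ‖(1 / 2 : ℝ) • (x + y) - p‖ ≤ d / 2) :
      f x - f y - barrier 0 S (S / (2 * d)) (4 * A / d ^ 2) p x y ≤ 0 := by
    refine le_zero_of_no_interior_max (p := p) (d := d) (ρ := d / 2) (G := fun z => f z.1 - f z.2 -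
      barrier 0 S (S / (2 * d)) (4 * A / d ^ 2) p z.1 z.2) ?_ ?_ ?_ ?_ hx hq
    · have := hf.continuous
      have := continuous_barrier 0 S (S / (2 * d)) (4 * A / d ^ 2) p
      exact Continuous.continuousOn (by fun_prop)
    · intro x y hx hq
      obtain ⟨m1, m2⟩ := mem_closedBall_of_midpoint hx.le hq (by linarith : d / 2 + d / 2 ≤ d)
      have h1 := hosc x m1 y m2
      have h2 := le_barrier (a := 0) (K := 4 * A / d ^ 2) (p := p) hd hS0 hx.le
      have h3 : 0 ≤ 4 * A / d ^ 2 * ‖(1 / 2 : ℝ) • (x + y) - p‖ ^ 2 := by positivity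
      have h4 : 0 ≤ B * d ^ 2 := by positivity
      rw [hx] at h2
      simp only
      linarith
    · intro x y hx hq
      obtain ⟨m1, m2⟩ := mem_closedBall_of_midpoint hx hq.le (by linarith : d / 2 + d / 2 ≤ d)
      have h1 := hosc x m1 y m2
      have h2 := le_barrier (a := 0) (K := 4 * A / d ^ 2) (p := p) hd hS0 hx
      have h3 : 4 * A / d ^ 2 * (d / 2) ^ 2 = A := by field_simp; norm_num
      have h4 : 0 ≤ S / 2 * ‖x - y‖ := by positivity
      rw [hq, h3] at h2
      simp only
      linarith
    · intro x y hx hq hpos hmax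
      obtain ⟨m1, m2⟩ := mem_closedBall_of_midpoint hx.le hq.le (by linarith : d / 2 + d / 2 ≤ d)
      have hne : x ≠ y := by
        rintro rfl
        have h2 := le_barrier (a := 0) (K := 4 * A / d ^ 2) (p := p) hd hS0 hx.le
        have h3 : 0 ≤ 4 * A / d ^ 2 * ‖(1 / 2 : ℝ) • (x + x) - p‖ ^ 2 := by positivity
        simp only [sub_self, norm_zero] at h2 hpos
        linarith
      have h1 := lap_add_lap_le hf hf.neg hne (by simpa only [sub_eq_add_neg] using hmax)
      rw [lap_neg hf] at h1
      have h2 := h0 x m1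
      have h3 := hB y m2
      have h4 : -8 * (S / (2 * d)) + 2 * (4 * A / d ^ 2) * (n - 1) = -8 * A / d ^ 2 - 4 * B := by
        rw [hS]
        field_simp
        ring
      have h5 : 0 < 8 * A / d ^ 2 := by positivity
      rw [h4, neg_mul, neg_div] at h1
      linarith
  refine ContinuousLinearMap.norm_le_of_forall_le hS0 fun θ => ?_
  have hder := (hasJet_line hf p θ).hasDerivAt.sub (hasJet_line hf p (-θ)).hasDerivAt
  suffices fderiv ℝ f p θ - fderiv ℝ f p (-θ) ≤ 2 * S * ‖θ‖ by
    rw [map_neg] at this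
    linarith
  refine hder.le_of_eventually_le ?_
  have hsmall : ∀ᶠ t : ℝ in 𝓝[>] 0, 2 * t * ‖θ‖ ≤ d := by
    have : ContinuousAt (fun t : ℝ => 2 * t * ‖θ‖) 0 := by fun_prop
    exact (this.eventually (ge_mem_nhds (by simpa using hd))).filter_mono nhdsWithin_le_nhds
  filter_upwards [hsmall, self_mem_nhdsWithin] with t ht ht0
  have e1 : p + t • θ - (p + t • -θ) = (2 * t) • θ := by module
  have e2 : (1 / 2 : ℝ) • (p + t • θ + (p + t • -θ)) = p := by module
  have e3 : ‖(2 * t) • θ‖ = 2 * t * ‖θ‖ := by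
    rw [norm_smul, Real.norm_of_nonneg (by linarith [Set.mem_Ioi.1 ht0])]
  have h1 := key (x := p + t • θ) (y := p + t • -θ) (by rw [e1, e3]; exact ht)
    (by rw [e2, sub_self, norm_zero]; positivity)
  have h2 := barrier_midpoint_le (a := 0) (S := S) (T := S / (2 * d)) (K := 4 * A / d ^ 2)
    (x := p + t • θ) (y := p + t • -θ) (by positivity)
  rw [e2, e1, e3] at h2
  simp only [Pi.sub_apply, zero_smul, add_zero, sub_self, sub_zero]
  linarith

end GradientEstimate

section Harnack

variable {n : ℕ} {u : EuclideanSpace ℝ (Fin n) → ℝ} {p z : EuclideanSpace ℝ (Fin n)}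

/-- Comparison with the radial subsolution `‖x - p‖ ^ (-2n)` on an annulus. -/
theorem le_of_annulus (hn : 1 ≤ n) (hu : ContDiff ℝ 2 u) (hpos : ∀ x, 0 < u x) {A ρ : ℝ}
    (hρ : 0 < ρ) (hA : 0 < A) (hlap : ∀ x ∈ closedBall p 2, lap u x ≤ u x)
    (hin : ∀ x, ‖x - p‖ = ρ → A ≤ u x) (hz : ρ ≤ ‖z - p‖) (hz1 : ‖z - p‖ ≤ 1) :
    3 / 4 * A * ρ ^ (2 * n) ≤ u z := by
  set B := A * ρ ^ (2 * n) with hB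
  have hB0 : 0 < B := by positivity
  set H : ℝ → ℝ := fun s => B * (s ^ (-(n : ℤ)) - 4 ^ (-(n : ℤ))) with hH
  set H₁ : ℝ → ℝ := fun s => B * ((-(n : ℤ) : ℤ) * s ^ (-(n : ℤ) - 1)) with hH₁
  set H₂ : ℝ → ℝ := fun s =>
    B * ((-(n : ℤ) : ℤ) * ((-(n : ℤ) - 1 : ℤ) * s ^ (-(n : ℤ) - 1 - 1))) with hH₂
  have d1 {s : ℝ} (hs : s ≠ 0) : HasDerivAt H (H₁ s) s :=
    ((hasDerivAt_zpow _ s (.inl hs)).sub_const _).const_mul B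
  have d2 {s : ℝ} (hs : s ≠ 0) : HasDerivAt H₁ (H₂ s) s :=
    ((hasDerivAt_zpow _ s (.inl hs)).const_mul _).const_mul B
  have hn' : (1 : ℝ) ≤ n := by exact_mod_cast hn
  set D : Set (EuclideanSpace ℝ (Fin n)) := {x | ρ ≤ ‖x - p‖ ∧ ‖x - p‖ ≤ 2} with hD
  have c1 : Continuous fun x : EuclideanSpace ℝ (Fin n) => ‖x - p‖ := by fun_prop
  have hclosed : IsClosed D :=
    (isClosed_le continuous_const c1).inter (isClosed_le c1 continuous_const)
  have hcomp : IsCompact D := (isCompact_closedBall p 2).of_isClosed_subset hclosed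
    fun x hx => by rw [mem_closedBall, dist_eq_norm]; exact hx.2
  have hmem : z ∈ D := ⟨hz, hz1.trans one_le_two⟩
  have hcont : ContinuousOn (fun x => H (‖x - p‖ ^ 2) - u x) D := by
    intro x hx
    have hx0 : ‖x - p‖ ^ 2 ≠ 0 := (pow_pos (hρ.trans_le hx.1) 2).ne'
    have h1 : ContinuousAt (fun x => H (‖x - p‖ ^ 2)) x :=
      ContinuousAt.comp (g := H) (d1 hx0).continuousAt (c1.pow 2).continuousAt
    exact (h1.sub hu.continuous.continuousAt).continuousWithinAt
  have hle : H (‖z - p‖ ^ 2) - u z ≤ 0 := by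
    obtain ⟨x, hx, hmax⟩ := hcomp.exists_isMaxOn ⟨_, hmem⟩ hcont
    refine (hmax hmem).trans ?_
    by_contra! hp
    have hx0 : 0 < ‖x - p‖ ^ 2 := pow_pos (hρ.trans_le hx.1) 2
    rcases hx.1.eq_or_lt with h1 | h1
    · have h2 := hin x h1.symm
      have h3 : B * (‖x - p‖ ^ 2) ^ (-(n : ℤ)) = A := by
        rw [← h1, zpow_neg, zpow_natCast, ← pow_mul, hB, mul_assoc, mul_inv_cancel₀ (by positivity),
          mul_one]
      have h4 : 0 < B * (4 : ℝ) ^ (-(n : ℤ)) := by positivity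
      simp only [hH, mul_sub] at hp
      linarith
    rcases hx.2.eq_or_lt with h2 | h2
    · have := hpos x
      simp only [hH, h2] at hp
      norm_num at hp
      linarith
    have o : IsOpen {x : EuclideanSpace ℝ (Fin n) | ρ < ‖x - p‖ ∧ ‖x - p‖ < 2} :=
      (isOpen_lt continuous_const c1).inter (isOpen_lt c1 continuous_const)
    have hloc : IsLocalMax (fun x => H (‖x - p‖ ^ 2) - u x) x :=
      hmax.isLocalMax (mem_of_superset (o.mem_nhds ⟨h1, h2⟩) fun y hy => ⟨hy.1.le, hy.2.le⟩)
    let b := EuclideanSpace.basisFun (Fin n) ℝ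
    set s := ‖x - p‖ ^ 2 with hs
    have key (i : Fin n) : H₂ s * (2 * ⟪x - p, b i⟫) ^ 2 + H₁ s * 2 ≤
        fderiv ℝ (fderiv ℝ u) x (b i) (b i) := by
      have hq : HasJet (fun t : ℝ => ‖x + t • b i - p‖ ^ 2) (2 * ⟪x - p, b i⟫) (2 * 1) := by
        refine (HasJet.quadratic s _ _).congr (.of_forall fun t => ?_)
        simp only
        rw [add_sub_right_comm, norm_add_smul_sq, b.norm_eq_one, one_pow]
      have hj := hq.comp (H := H) (H' := H₁) (h₂ := H₂ s)
        (by
          simp only [zero_smul, add_zero]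
          filter_upwards [lt_mem_nhds hx0] with t ht using d1 ht.ne')
        (by simpa using d2 hx0.ne')
      have hline : IsLocalMax (fun t : ℝ => H (‖x + t • b i - p‖ ^ 2) - u (x + t • b i)) 0 := by
        have hc : ContinuousAt (fun t : ℝ => x + t • b i) 0 := by fun_prop
        have h' : IsLocalMax (fun x => H (‖x - p‖ ^ 2) - u x) ((fun t : ℝ => x + t • b i) 0) := by
          simpa using hloc
        exact hc.tendsto.eventually h'
      have := (hj.sub (hasJet_line hu x (b i))).nonpos_of_isLocalMax hline
      simp only [zero_smul, add_zero, ← hs] at this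
      linarith
    have hsum := Finset.sum_le_sum fun i (_ : i ∈ Finset.univ) => key i
    rw [← lap_eq_sum b] at hsum
    simp only [mul_pow, Finset.sum_add_distrib, ← Finset.mul_sum, sum_sq_inner b, ← hs] at hsum
    simp only [Finset.sum_const, Finset.card_univ, Fintype.card_fin, nsmul_eq_mul] at hsum
    have hlapx := hlap x (by rw [mem_closedBall, dist_eq_norm]; exact hx.2)
    have hs4 : s ≤ 4 := by
      have := pow_le_pow_left₀ (norm_nonneg _) hx.2 2
      linarith
    set P := s ^ (-(n : ℤ) - 1) with hP
    have hP0 : 0 < P := zpow_pos hx0 _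
    have e1 : s ^ (-(n : ℤ)) = P * s := by rw [hP, ← zpow_add_one₀ hx0.ne', sub_add_cancel]
    have e2 : s ^ (-(n : ℤ) - 1 - 1) * s = P := by rw [← zpow_add_one₀ hx0.ne', sub_add_cancel]
    have e3 : H₂ s * (2 ^ 2 * s) + n * (H₁ s * 2) = B * P * (2 * n * (n + 2)) := by
      have : H₂ s * (2 ^ 2 * s) =
          4 * B * (n * (n + 1)) * (s ^ (-(n : ℤ) - 1 - 1) * s) := by
        simp only [hH₂]
        push_cast
        ring
      rw [this, e2]
      simp only [hH₁]
      push_cast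
      ring
    have e4 : H s ≤ B * P * 4 := by
      have h4 : 0 < B * (4 : ℝ) ^ (-(n : ℤ)) := by positivity
      have : B * P * s ≤ B * P * 4 := by gcongr
      simp only [hH, mul_sub, e1]
      linarith
    have e5 : B * P * 4 ≤ B * P * (2 * n * (n + 2)) := by
      gcongr
      nlinarith
    linarith
  have hzs : 1 ≤ (‖z - p‖ ^ 2) ^ (-(n : ℤ)) := by
    rw [zpow_neg, zpow_natCast]
    exact (one_le_inv₀ (by have := hρ.trans_le hz; positivity)).2
      (pow_le_one₀ (by positivity) (pow_le_one₀ (norm_nonneg _) hz1))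
  have h4 : (4 : ℝ) ^ (-(n : ℤ)) ≤ 1 / 4 := by
    rw [zpow_neg, zpow_natCast, one_div]
    exact inv_anti₀ (by norm_num) (le_self_pow₀ (by norm_num) (by omega))
  have : B * (3 / 4) ≤ H (‖z - p‖ ^ 2) := by
    simp only [hH]
    gcongr
    linarith
  linarith

/-- Harnack inequality for positive solutions of `0 ≤ Δu ≤ u`. -/
theorem exists_harnack_constant (hn : 1 ≤ n) : ∃ c : ℝ, 0 < c ∧
    ∀ (u : EuclideanSpace ℝ (Fin n) → ℝ) (z : EuclideanSpace ℝ (Fin n)), ContDiff ℝ 2 u →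
      (∀ x, 0 < u x) → (∀ x ∈ closedBall z 3, 0 ≤ lap u x) →
      (∀ x ∈ closedBall z 3, lap u x ≤ u x) → ∀ x ∈ closedBall z (1 / 2), u x ≤ c * u z := by
  set c₁ : ℝ := 2 ^ (2 * n) * (8 * n + 1) with hc₁
  have hc₁1 : 1 ≤ c₁ := by
    have : (1 : ℝ) ≤ 2 ^ (2 * n) := one_le_pow₀ (by norm_num)
    have hn0 : (0 : ℝ) ≤ n := n.cast_nonneg
    nlinarith
  set η : ℝ := 1 / (4 * c₁) with hη
  have hη0 : 0 < η := by positivity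
  have hη4 : η ≤ 1 / 4 := by
    rw [hη, div_le_div_iff₀ (by positivity) (by norm_num)]
    linarith
  have hcη : c₁ * η = 1 / 4 := by rw [hη]; field_simp
  refine ⟨8 / 3 * (2 / η) ^ (2 * n), by positivity, fun u z hu hpos h0 hle x hx => ?_⟩
  have c1 : Continuous fun x : EuclideanSpace ℝ (Fin n) => ‖x - z‖ := by fun_prop
  have hcont : Continuous fun x => u x * (1 - ‖x - z‖) ^ (2 * n) := by
    have := hu.continuous
    fun_prop
  obtain ⟨x₁, hx₁, hmax⟩ := (isCompact_closedBall z 1).exists_isMaxOn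
    ⟨z, mem_closedBall_self zero_le_one⟩ hcont.continuousOn
  rw [mem_closedBall, dist_eq_norm] at hx₁ hx
  have hmax' (y : EuclideanSpace ℝ (Fin n)) (hy : ‖y - z‖ ≤ 1) :
      u y * (1 - ‖y - z‖) ^ (2 * n) ≤ u x₁ * (1 - ‖x₁ - z‖) ^ (2 * n) :=
    hmax (show y ∈ closedBall z 1 by rwa [mem_closedBall, dist_eq_norm])
  set d := 1 - ‖x₁ - z‖ with hd
  set A := u x₁ with hA
  have hA0 : 0 < A := hpos x₁
  have hd1 : d ≤ 1 := by linarith [norm_nonneg (x₁ - z)]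
  have hd0 : 0 < d := by
    refine lt_of_le_of_ne (by linarith) fun h => ?_
    have h1 := hmax' z (by simp)
    rw [← h, zero_pow (by omega)] at h1
    simp at h1
    linarith [hpos z]
  have hbd (y : EuclideanSpace ℝ (Fin n)) (hy : ‖y - x₁‖ ≤ d / 2) :
      u y ≤ 2 ^ (2 * n) * A ∧ y ∈ closedBall z 3 := by
    have h1 : ‖y - z‖ ≤ ‖y - x₁‖ + ‖x₁ - z‖ := norm_sub_le_norm_sub_add_norm_sub _ _ _
    refine ⟨?_, by rw [mem_closedBall, dist_eq_norm]; linarith⟩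
    have h2 := hmax' y (by linarith)
    have h3 : u y * (d / 2) ^ (2 * n) ≤ u y * (1 - ‖y - z‖) ^ (2 * n) := by
      have := (hpos y).le
      gcongr
      linarith
    have h4 := h3.trans h2
    rw [div_pow, mul_div_assoc', div_le_iff₀ (by positivity)] at h4
    have h5 : 0 < d ^ (2 * n) := by positivity
    refine le_of_mul_le_mul_right ?_ h5
    linarith
  have hgrad (y : EuclideanSpace ℝ (Fin n)) (hy : y ∈ closedBall x₁ (d / 4)) :
      ‖fderiv ℝ u y‖ ≤ c₁ * A / d := by
    rw [mem_closedBall, dist_eq_norm] at hy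
    have hw (w : EuclideanSpace ℝ (Fin n)) (hw : w ∈ closedBall y (d / 4)) :
        ‖w - x₁‖ ≤ d / 2 := by
      rw [mem_closedBall, dist_eq_norm] at hw
      linarith [norm_sub_le_norm_sub_add_norm_sub w y x₁]
    have := norm_fderiv_le (A := 2 ^ (2 * n) * A) (B := 2 ^ (2 * n) * A) hn hu
      (by positivity : 0 < d / 4) (by positivity)
      (fun w h1 w' _ => by linarith [(hbd w (hw w h1)).1, hpos w'])
      (fun w h1 => h0 w (hbd w (hw w h1)).2)
      (fun w h1 => (hle w (hbd w (hw w h1)).2).trans (hbd w (hw w h1)).1)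
    refine this.trans ?_
    have e1 : 2 * n * (2 ^ (2 * n) * A) / (d / 4) = 2 ^ (2 * n) * (8 * n) * A / d := by
      field_simp
      ring
    have e2 : c₁ * A / d = 2 ^ (2 * n) * (8 * n) * A / d + 2 ^ (2 * n) * A * (1 / d) := by
      rw [hc₁]
      field_simp
    rw [e1, e2]
    gcongr
    linarith
  have hlow (y : EuclideanSpace ℝ (Fin n)) (hy : ‖y - x₁‖ ≤ η * d) : A / 2 ≤ u y := by
    have hηd : η * d ≤ d / 4 := by nlinarith
    have hmv := (convex_closedBall x₁ (d / 4)).norm_image_sub_le_of_norm_fderiv_le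
      (𝕜 := ℝ) (f := u) (C := c₁ * A / d) (x := x₁) (y := y)
      (fun w _ => (hu.differentiable (by norm_num)) w) hgrad
      (mem_closedBall_self (by positivity))
      (by rw [mem_closedBall, dist_eq_norm]; linarith)
    have h1 : c₁ * A / d * ‖y - x₁‖ ≤ c₁ * A / d * (η * d) := by gcongr
    have h2 : c₁ * A / d * (η * d) = A / 4 := by
      have : c₁ * A / d * (η * d) = A * (c₁ * η) := by field_simp
      rw [this, hcη]
      ring
    rw [Real.norm_eq_abs] at hmv
    linarith [neg_abs_le (u y - u x₁)]
  have hmain : 3 / 8 * A * (η * d) ^ (2 * n) ≤ u z := by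
    have hηd1 : η * d ≤ 1 := by nlinarith
    rcases le_total ‖z - x₁‖ (η * d) with h | h
    · have h1 := hlow z h
      have h2 : (η * d) ^ (2 * n) ≤ 1 := pow_le_one₀ (by positivity) hηd1
      nlinarith
    · have := le_of_annulus (p := x₁) (A := A / 2) hn hu hpos (by positivity) (by positivity)
        (fun w hw => hle w (by
          rw [mem_closedBall, dist_eq_norm] at hw ⊢
          linarith [norm_sub_le_norm_sub_add_norm_sub w x₁ z]))
        (fun w hw => hlow w hw.le) h (by rwa [norm_sub_rev])
      linarith
  have hxm := hmax' x (by linarith)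
  have h1 : u x * (1 / 2) ^ (2 * n) ≤ u x * (1 - ‖x - z‖) ^ (2 * n) := by
    have := (hpos x).le
    gcongr
    linarith
  have h2 : u x * (1 / 2) ^ (2 * n) ≤ A * d ^ (2 * n) := h1.trans hxm
  calc u x = 2 ^ (2 * n) * (u x * (1 / 2) ^ (2 * n)) := by
        rw [one_div, inv_pow]
        field_simp
    _ ≤ 2 ^ (2 * n) * (A * d ^ (2 * n)) := by gcongr
    _ = 8 / 3 * (2 / η) ^ (2 * n) * (3 / 8 * A * (η * d) ^ (2 * n)) := by
        rw [div_pow, mul_pow]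
        field_simp
    _ ≤ 8 / 3 * (2 / η) ^ (2 * n) * u z := by gcongr

end Harnack

section ProductBound

variable {n : ℕ} {u v : EuclideanSpace ℝ (Fin n) → ℝ} {N S T K R C₀ : ℝ}
  {p x y : EuclideanSpace ℝ (Fin n)}

theorem IsSolution.symm (h : IsSolution u v) : IsSolution v u :=
  ⟨h.2.1, h.1, h.2.2.2.1, h.2.2.1, h.2.2.2.2.2, h.2.2.2.2.1⟩

theorem IsSolution.contDiff_two (h : IsSolution u v) : ContDiff ℝ 2 u :=
  contDiff_infty.1 h.1 2

theorem IsSolution.pos (h : IsSolution u v) : ∀ x, 0 < u x := h.2.2.1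

theorem IsSolution.lap_eq (h : IsSolution u v) : ∀ x, lap u x = u x * v x ^ 2 := h.2.2.2.2.1

theorem IsSolution.lap_log_eq (h : IsSolution u v)
    (b : OrthonormalBasis (Fin n) ℝ (EuclideanSpace ℝ (Fin n))) (x : EuclideanSpace ℝ (Fin n)) :
    lap (fun y => Real.log (u y)) x =
      v x ^ 2 - ∑ i, (fderiv ℝ (fun y => Real.log (u y)) x (b i)) ^ 2 := by
  rw [lap_log h.contDiff_two h.pos b, h.lap_eq, mul_div_cancel_left₀ _ (h.pos x).ne']

theorem sum_sq_linear_combination (b : OrthonormalBasis (Fin n) ℝ (EuclideanSpace ℝ (Fin n)))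
    (e q : EuclideanSpace ℝ (Fin n)) (α β : ℝ) :
    ∑ i, (α * ⟪e, b i⟫ + β * ⟪q, b i⟫) ^ 2 =
      α ^ 2 * ‖e‖ ^ 2 + 2 * α * β * ⟪q, e⟫ + β ^ 2 * ‖q‖ ^ 2 := by
  rw [← sum_sq_inner b e, ← sum_sq_inner b q, ← sum_inner_mul b q e, Finset.mul_sum,
    Finset.mul_sum, Finset.mul_sum, ← Finset.sum_add_distrib, ← Finset.sum_add_distrib]
  exact Finset.sum_congr rfl fun i _ => by ring

theorem growth_le_of_mem_closedBall (hC₀ : 0 < C₀) (hgrowth : ∀ x, u x + v x ≤ C₀ * (1 + ‖x‖))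
    (hR : 1 + ‖p‖ ≤ R) (hx : x ∈ closedBall p (3 / 2 * R)) : u x + v x ≤ 4 * C₀ * R := by
  rw [mem_closedBall, dist_eq_norm] at hx
  have h1 : ‖x‖ ≤ ‖x - p‖ + ‖p‖ := by simpa using norm_add_le (x - p) p
  have h2 : C₀ * (1 + ‖x‖) ≤ C₀ * (4 * R) := by
    gcongr
    linarith [norm_nonneg p]
  linarith [hgrowth x]

theorem hasDerivAt_two_mul_log {s : ℝ} (hs : s ≠ 0) :
    HasDerivAt (fun s => 2 * Real.log s) (2 * s⁻¹) s :=
  (Real.hasDerivAt_log hs).const_mul 2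

theorem hasDerivAt_two_mul_inv {s : ℝ} (hs : s ≠ 0) :
    HasDerivAt (fun s : ℝ => 2 * s⁻¹) (2 * -(s ^ 2)⁻¹) s :=
  (hasDerivAt_inv hs).const_mul 2

/-- At an off-diagonal maximum of the logarithmic doubled function the concavity of the barrier
is contradicted. -/
theorem IsSolution.not_isLocalMax_log (h : IsSolution u v) (hxy : x ≠ y)
    (hψ : 0 < barrier N S T K p x y) (hK : 0 < K) (hT : K * (n + 1) ≤ T)
    (hq : K * ‖(1 / 2 : ℝ) • (x + y) - p‖ ^ 2 ≤ barrier N S T K p x y) :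
    ¬ IsLocalMax (fun z : EuclideanSpace ℝ (Fin n) × EuclideanSpace ℝ (Fin n) =>
      Real.log (u z.1) + Real.log (v z.2) - 2 * Real.log (barrier N S T K p z.1 z.2)) (x, y) := by
  intro hm
  obtain ⟨e, he, hxe⟩ := exists_unit_direction hxy
  have hr := norm_pos_iff.2 (sub_ne_zero.2 hxy)
  have hf : ContDiff ℝ 2 fun x => Real.log (u x) := h.contDiff_two.log fun x => (h.pos x).ne'
  have hg : ContDiff ℝ 2 fun x => Real.log (v x) :=
    h.symm.contDiff_two.log fun x => (h.symm.pos x).ne'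
  have h2 := lap_add_lap_le_of_isLocalMax (H := fun s => 2 * Real.log s) (H' := fun s => 2 * s⁻¹)
    hf hg he hr hxe
    (by filter_upwards [lt_mem_nhds hψ] with s hs using hasDerivAt_two_mul_log hs.ne')
    (hasDerivAt_two_mul_inv hψ.ne') hm
  have h1 := fderiv_eq_of_isLocalMax (H := fun s => 2 * Real.log s) hf hg he hr hxe
    (hasDerivAt_two_mul_log hψ.ne') hm
  let b := EuclideanSpace.basisFun (Fin n) ℝ
  rw [h.lap_log_eq b, h.symm.lap_log_eq b] at h2
  simp only [h1, mul_pow, ← Finset.mul_sum, sum_sq_linear_combination, he] at h2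
  set q := (1 / 2 : ℝ) • (x + y) - p
  set σ := S - 2 * T * ‖x - y‖
  set ψ := barrier N S T K p x y
  have hqe : ⟪q, e⟫ ^ 2 ≤ ‖q‖ ^ 2 := by
    have := abs_real_inner_le_norm q e
    rw [he, mul_one] at this
    exact sq_le_sq' (neg_le_of_abs_le this) (le_of_abs_le this)
  have h3 : v x ^ 2 + u y ^ 2 ≤
      2 * ψ⁻¹ * (-8 * T + 2 * K * (n - 1)) + 8 * (ψ⁻¹) ^ 2 * (K ^ 2 * ⟪q, e⟫ ^ 2) := by
    have e1 : (ψ ^ 2)⁻¹ = ψ⁻¹ ^ 2 := by rw [inv_pow]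
    rw [e1] at h2
    linarith
  have h4 : K ^ 2 * ⟪q, e⟫ ^ 2 ≤ K * ψ := by
    calc K ^ 2 * ⟪q, e⟫ ^ 2 ≤ K ^ 2 * ‖q‖ ^ 2 := by gcongr
      _ = K * (K * ‖q‖ ^ 2) := by ring
      _ ≤ K * ψ := by gcongr
  have h5 : 8 * ψ⁻¹ ^ 2 * (K ^ 2 * ⟪q, e⟫ ^ 2) ≤ 8 * ψ⁻¹ ^ 2 * (K * ψ) := by gcongr
  have h6 : 8 * ψ⁻¹ ^ 2 * (K * ψ) = 2 * ψ⁻¹ * (4 * K) := by field_simp; norm_num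
  have h7 : 2 * ψ⁻¹ * (-8 * T + 2 * K * (n - 1) + 4 * K) ≤ 0 := by
    refine mul_nonpos_of_nonneg_of_nonpos (by positivity) ?_
    nlinarith [n.cast_nonneg (α := ℝ)]
  have h8 : 0 < v x ^ 2 := pow_pos (h.symm.pos x) 2
  nlinarith [sq_nonneg (u y)]

theorem barrier_line_le (hT : 0 ≤ T) {t : ℝ} (ht : 0 ≤ t) (α β : EuclideanSpace ℝ (Fin n)) :
    barrier N S T K p (x + t • α) (x + t • β) ≤
      N + K * ‖(1 / 2 : ℝ) • (x + x) - p‖ ^ 2 +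
      (S * ‖α - β‖ + K * ⟪(1 / 2 : ℝ) • (x + x) - p, α + β⟫) * t +
      K * ‖(1 / 2 : ℝ) • (α + β)‖ ^ 2 * t ^ 2 := by
  have e1 : x + t • α - (x + t • β) = t • (α - β) := by module
  have e2 : (1 / 2 : ℝ) • (x + t • α + (x + t • β)) - p =
      ((1 / 2 : ℝ) • (x + x) - p) + t • ((1 / 2 : ℝ) • (α + β)) := by module
  rw [barrier, e1, e2, norm_add_smul_sq, norm_smul, Real.norm_of_nonneg ht, inner_smul_right]
  have : 0 ≤ T * (t * ‖α - β‖) ^ 2 := by positivity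
  linarith

theorem barrier_self : barrier N S T K p x x = N + K * ‖(1 / 2 : ℝ) • (x + x) - p‖ ^ 2 := by
  simp [barrier]

/-- First order condition at a diagonal maximum of the logarithmic doubled function. -/
theorem fderiv_add_fderiv_le_of_isLocalMax_log {f g : EuclideanSpace ℝ (Fin n) → ℝ}
    (hf : ContDiff ℝ 2 f) (hg : ContDiff ℝ 2 g) (hT : 0 ≤ T)
    (hψ : ∀ x y, ‖x - y‖ ≤ R → 0 < barrier N S T K p x y) (hR : 0 < R)
    (hm : IsLocalMax (fun z : EuclideanSpace ℝ (Fin n) × EuclideanSpace ℝ (Fin n) =>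
      f z.1 + g z.2 - 2 * Real.log (barrier N S T K p z.1 z.2)) (x, x))
    (α β : EuclideanSpace ℝ (Fin n)) :
    fderiv ℝ f x α + fderiv ℝ g x β ≤ 2 * (barrier N S T K p x x)⁻¹ *
      (S * ‖α - β‖ + K * ⟪(1 / 2 : ℝ) • (x + x) - p, α + β⟫) := by
  set P : ℝ → ℝ := fun t => N + K * ‖(1 / 2 : ℝ) • (x + x) - p‖ ^ 2 +
      (S * ‖α - β‖ + K * ⟪(1 / 2 : ℝ) • (x + x) - p, α + β⟫) * t +
      K * ‖(1 / 2 : ℝ) • (α + β)‖ ^ 2 * t ^ 2 with hP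
  have hP0 : P 0 = barrier N S T K p x x := by simp [hP, barrier_self]
  have hψ0 := hψ x x (by simpa using hR.le)
  have hj := ((HasJet.quadratic (N + K * ‖(1 / 2 : ℝ) • (x + x) - p‖ ^ 2)
    (S * ‖α - β‖ + K * ⟪(1 / 2 : ℝ) • (x + x) - p, α + β⟫)
    (K * ‖(1 / 2 : ℝ) • (α + β)‖ ^ 2)).hasDerivAt)
  have hd := ((hasJet_line hf x α).hasDerivAt.add (hasJet_line hg x β).hasDerivAt).sub
    (HasDerivAt.comp (0 : ℝ) (h := P)
      (hasDerivAt_two_mul_log (s := P 0) (by rw [hP0]; exact hψ0.ne')) hj)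
  have := hd.le_of_eventually_le (M := 0) ?_
  · rw [hP0] at this
    linarith
  have hsmall : ∀ᶠ t : ℝ in 𝓝 0, ‖x + t • α - (x + t • β)‖ ≤ R := by
    have : ContinuousAt (fun t : ℝ => ‖x + t • α - (x + t • β)‖) 0 := by fun_prop
    exact this.eventually (ge_mem_nhds (by simpa using hR))
  filter_upwards [hsmall.filter_mono nhdsWithin_le_nhds,
    (hm.comp_line α β).filter_mono nhdsWithin_le_nhds, self_mem_nhdsWithin] with t h1 h2 h3
  have h4 := Real.log_le_log (hψ _ _ h1)
    (barrier_line_le (N := N) (S := S) (K := K) (p := p) (x := x) hT (le_of_lt h3) α β)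
  simp only [Pi.sub_apply, Pi.add_apply, Function.comp, zero_smul, add_zero, hP0] at h2 ⊢
  change _ ≤ Real.log (P t) at h4
  linarith

theorem IsSolution.le_of_diagonal_isLocalMax_log (h : IsSolution u v) (hT : 0 ≤ T)
    (hK : 0 ≤ K) (hψ : ∀ x y, ‖x - y‖ ≤ R → 0 < barrier N S T K p x y) (hR : 0 < R)
    (hm : IsLocalMax (fun z : EuclideanSpace ℝ (Fin n) × EuclideanSpace ℝ (Fin n) =>
      Real.log (u z.1) + Real.log (v z.2) - 2 * Real.log (barrier N S T K p z.1 z.2)) (x, x)) :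
    v x ^ 2 + u x ^ 2 ≤ 4 * n * K * (barrier N S T K p x x)⁻¹ + 8 * n *
      (S + K * ‖(1 / 2 : ℝ) • (x + x) - p‖) ^ 2 * (barrier N S T K p x x)⁻¹ ^ 2 := by
  have hf : ContDiff ℝ 2 fun x => Real.log (u x) := h.contDiff_two.log fun x => (h.pos x).ne'
  have hg : ContDiff ℝ 2 fun x => Real.log (v x) :=
    h.symm.contDiff_two.log fun x => (h.symm.pos x).ne'
  have hψ0 := hψ x x (by simpa using hR.le)
  have hfirst := fderiv_add_fderiv_le_of_isLocalMax_log hf hg hT hψ hR hm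
  set f := fun x => Real.log (u x)
  set g := fun x => Real.log (v x)
  have hψe := barrier_self (N := N) (S := S) (T := T) (K := K) (p := p) (x := x)
  set q := (1 / 2 : ℝ) • (x + x) - p with hq
  set ψ := barrier N S T K p x x
  let b := EuclideanSpace.basisFun (Fin n) ℝ
  have hψi : 0 < ψ⁻¹ := inv_pos.2 hψ0
  have hbound (θ : EuclideanSpace ℝ (Fin n)) (hθ : ‖θ‖ = 1) :
      S * ‖θ‖ + K * ⟪q, θ⟫ ≤ S + K * ‖q‖ := by
    have h1 := real_inner_le_norm q θ
    rw [hθ, mul_one] at *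
    gcongr
  have hb (θ : EuclideanSpace ℝ (Fin n)) (hθ : ‖θ‖ = 1) :
      fderiv ℝ f x θ ≤ 2 * ψ⁻¹ * (S + K * ‖q‖) ∧ fderiv ℝ g x θ ≤ 2 * ψ⁻¹ * (S + K * ‖q‖) := by
    have h1 := hfirst θ 0
    have h2 := hfirst 0 θ
    simp only [map_zero, add_zero, zero_add, sub_zero, zero_sub, norm_neg] at h1 h2
    have h3 := mul_le_mul_of_nonneg_left (hbound θ hθ) (by positivity : 0 ≤ 2 * ψ⁻¹)
    exact ⟨h1.trans h3, h2.trans h3⟩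
  have hsq (i : Fin n) : (fderiv ℝ f x (b i)) ^ 2 + (fderiv ℝ g x (b i)) ^ 2 ≤
      2 * (2 * ψ⁻¹ * (S + K * ‖q‖)) ^ 2 := by
    obtain ⟨h1, h2⟩ := hb (b i) (b.norm_eq_one i)
    obtain ⟨h3, h4⟩ := hb (-b i) (by rw [norm_neg, b.norm_eq_one])
    rw [map_neg] at h3 h4
    have h5 := sq_le_sq' (by linarith) h1
    have h6 := sq_le_sq' (by linarith) h2
    linarith
  have hsecond (i : Fin n) : fderiv ℝ (fderiv ℝ f) x (b i) (b i) +
      fderiv ℝ (fderiv ℝ g) x (b i) (b i) ≤ 4 * K * ψ⁻¹ := by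
    have hj : HasJet (fun t : ℝ => barrier N S T K p (x + t • b i) (x + t • b i))
        (2 * K * ⟪q, b i⟫) (2 * K) := by
      refine (HasJet.quadratic ψ _ _).congr (.of_forall fun t => ?_)
      have e2 : (1 / 2 : ℝ) • (x + t • b i + (x + t • b i)) - p = q + t • b i := by
        rw [hq]
        module
      simp only [barrier_self, e2, hψe, norm_add_smul_sq, b.norm_eq_one]
      ring
    have hj2 := hj.comp (H := fun s => 2 * Real.log s) (H' := fun s => 2 * s⁻¹)
      (h₂ := 2 * -(ψ ^ 2)⁻¹)
      (by
        simp only [zero_smul, add_zero]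
        filter_upwards [lt_mem_nhds hψ0] with s hs using hasDerivAt_two_mul_log hs.ne')
      (by simpa using hasDerivAt_two_mul_inv hψ0.ne')
    have := (((hasJet_line hf x (b i)).add (hasJet_line hg x (b i))).sub
      hj2).nonpos_of_isLocalMax (hm.comp_line (b i) (b i))
    simp only [zero_smul, add_zero] at this
    change _ - (2 * -(ψ ^ 2)⁻¹ * (2 * K * ⟪q, b i⟫) ^ 2 + 2 * ψ⁻¹ * (2 * K)) ≤ 0 at this
    have h2 : 0 ≤ (ψ ^ 2)⁻¹ * (2 * K * ⟪q, b i⟫) ^ 2 := by positivity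
    linarith
  have hs1 := Finset.sum_le_sum fun i (_ : i ∈ Finset.univ) => hsq i
  have hs2 := Finset.sum_le_sum fun i (_ : i ∈ Finset.univ) => hsecond i
  rw [Finset.sum_add_distrib] at hs1 hs2
  rw [← lap_eq_sum b, ← lap_eq_sum b, h.lap_log_eq b, h.symm.lap_log_eq b] at hs2
  simp only [Finset.sum_const, Finset.card_univ, Fintype.card_fin, nsmul_eq_mul] at hs1 hs2
  linarith

/-- A quantitative segregation estimate, obtained from the logarithmic two-point function. -/
theorem IsSolution.exists_mul_le (h : IsSolution u v) (hC₀ : 0 < C₀)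
    (hgrowth : ∀ x, u x + v x ≤ C₀ * (1 + ‖x‖)) :
    ∃ N S : ℝ, 1 ≤ N ∧ 0 ≤ S ∧ ∀ x y, u x * v y ≤ (N + S * ‖x - y‖) ^ 2 := by
  set S := 8 * C₀ * (n + 1) with hS
  have hS0 : 0 < S := by positivity
  set N := 2 * n * (4 * C₀) + 4 * n * (S + 4 * C₀) ^ 2 + 1 with hN
  have hN1 : 1 ≤ N := by
    have : 0 ≤ 2 * n * (4 * C₀) + 4 * n * (S + 4 * C₀) ^ 2 := by positivity
    linarith
  refine ⟨N, S, hN1, hS0.le, fun x₀ y₀ => ?_⟩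
  set p := (1 / 2 : ℝ) • (x₀ + y₀) with hp
  obtain ⟨R, hR1, hR2⟩ : ∃ R, 1 + ‖p‖ ≤ R ∧ ‖x₀ - y₀‖ ≤ R := ⟨_, le_max_left _ _, le_max_right _ _⟩
  have hR : 1 ≤ R := by linarith [norm_nonneg p]
  have hR0 : 0 < R := by linarith
  set T := S / (2 * R) with hT
  set K := 4 * C₀ / R with hK
  have hK0 : 0 < K := by positivity
  have hKR : K * R = 4 * C₀ := by rw [hK]; field_simp
  have hψN {x y : EuclideanSpace ℝ (Fin n)} (hxy : ‖x - y‖ ≤ R) :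
      N + S / 2 * ‖x - y‖ + K * ‖(1 / 2 : ℝ) • (x + y) - p‖ ^ 2 ≤ barrier N S T K p x y :=
    le_barrier hR0 hS0.le hxy
  have hψpos (x y : EuclideanSpace ℝ (Fin n)) (hxy : ‖x - y‖ ≤ R) :
      0 < barrier N S T K p x y := by
    have : 0 ≤ S / 2 * ‖x - y‖ + K * ‖(1 / 2 : ℝ) • (x + y) - p‖ ^ 2 := by positivity
    linarith [hψN hxy]
  have hbdry {x y : EuclideanSpace ℝ (Fin n)} (hx : ‖x - y‖ ≤ R)
      (hq : ‖(1 / 2 : ℝ) • (x + y) - p‖ ≤ R) (hle : 4 * C₀ * R ≤ barrier N S T K p x y) :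
      Real.log (u x) + Real.log (v y) - 2 * Real.log (barrier N S T K p x y) ≤ 0 := by
    obtain ⟨m1, m2⟩ := mem_closedBall_of_midpoint hx hq (by linarith : R + R / 2 ≤ 3 / 2 * R)
    have h1 := growth_le_of_mem_closedBall hC₀ hgrowth hR1 m1
    have h2 := growth_le_of_mem_closedBall hC₀ hgrowth hR1 m2
    have h3 := Real.log_le_log (h.pos x) (by linarith [h.symm.pos x] : u x ≤ 4 * C₀ * R)
    have h4 := Real.log_le_log (h.symm.pos y) (by linarith [h.pos y] : v y ≤ 4 * C₀ * R)
    have h5 := Real.log_le_log (by positivity) hle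
    linarith
  have key : Real.log (u x₀) + Real.log (v y₀) - 2 * Real.log (barrier N S T K p x₀ y₀) ≤ 0 := by
    refine le_zero_of_no_interior_max (p := p) (d := R) (ρ := R) (G := fun z =>
      Real.log (u z.1) + Real.log (v z.2) - 2 * Real.log (barrier N S T K p z.1 z.2))
      ?_ ?_ ?_ ?_ hR2 (by rw [← hp, sub_self, norm_zero]; exact hR0.le)
    · have h1 : Continuous fun x => Real.log (u x) :=
        h.contDiff_two.continuous.log fun x => (h.pos x).ne'
      have h2 : Continuous fun x => Real.log (v x) :=
        h.symm.contDiff_two.continuous.log fun x => (h.symm.pos x).ne'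
      have h3 : ContinuousOn (fun z : EuclideanSpace ℝ (Fin n) × EuclideanSpace ℝ (Fin n) =>
          Real.log (barrier N S T K p z.1 z.2))
          {z | ‖z.1 - z.2‖ ≤ R ∧ ‖(1 / 2 : ℝ) • (z.1 + z.2) - p‖ ≤ R} :=
        (continuous_barrier N S T K p).continuousOn.log fun z hz => (hψpos _ _ hz.1).ne'
      exact ((h1.comp continuous_fst).add (h2.comp continuous_snd)).continuousOn.sub
        (continuousOn_const.mul h3)
    · intro x y hx hq
      refine hbdry hx.le hq ?_
      have h1 := hψN hx.le
      have h2 : 0 ≤ K * ‖(1 / 2 : ℝ) • (x + y) - p‖ ^ 2 := by positivity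
      have h3 : 0 ≤ 4 * C₀ * n * R := by positivity
      rw [hx, hS] at h1
      linarith
    · intro x y hx hq
      refine hbdry hx hq.le ?_
      have h1 := hψN hx
      have h2 : 0 ≤ S / 2 * ‖x - y‖ := by positivity
      have h3 : K * R ^ 2 = 4 * C₀ * R := by rw [sq, ← mul_assoc, hKR]
      rw [hq, h3] at h1
      linarith
    · intro x y hx hq hpos hmax
      have h1 := hψN hx.le
      by_cases hxy : x = y
      · subst hxy
        have h2 := h.le_of_diagonal_isLocalMax_log (by positivity) hK0.le hψpos hR0 hmax
        have h3 : 0 ≤ K * ‖(1 / 2 : ℝ) • (x + x) - p‖ ^ 2 := by positivity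
        have h4 : K * ‖(1 / 2 : ℝ) • (x + x) - p‖ ≤ 4 * C₀ := by
          rw [← hKR]
          gcongr
        have hK1 : K ≤ 4 * C₀ := by
          rw [← hKR]
          exact le_mul_of_one_le_right hK0.le hR
        have hψ0 := hψpos x x hx.le
        simp only [sub_self, norm_zero, mul_zero, add_zero] at h1
        simp only at hpos
        set ψ := barrier N S T K p x x
        have hψ1 : N ≤ ψ := by linarith
        have h5 : ψ ^ 2 < u x * v x := by
          rw [← Real.log_lt_log_iff (by positivity) (mul_pos (h.pos x) (h.symm.pos x)),
            Real.log_pow, Real.log_mul (h.pos x).ne' (h.symm.pos x).ne']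
          push_cast
          linarith
        have h6 : 2 * ψ ^ 2 < 4 * n * (4 * C₀) * ψ⁻¹ + 8 * n * (S + 4 * C₀) ^ 2 * ψ⁻¹ ^ 2 := by
          calc 2 * ψ ^ 2 < v x ^ 2 + u x ^ 2 := by nlinarith [sq_nonneg (v x - u x)]
            _ ≤ _ := h2
            _ ≤ _ := by gcongr
        have h7 := mul_lt_mul_of_pos_right h6 (by positivity : 0 < ψ ^ 2)
        have h8 : (4 * n * (4 * C₀) * ψ⁻¹ + 8 * n * (S + 4 * C₀) ^ 2 * ψ⁻¹ ^ 2) * ψ ^ 2 =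
            4 * n * (4 * C₀) * ψ + 8 * n * (S + 4 * C₀) ^ 2 := by field_simp
        rw [h8] at h7
        have hn1 : 1 ≤ ψ := hN1.trans hψ1
        have h9 : N * ψ ≤ ψ ^ 2 * ψ ^ 2 := by
          calc N * ψ ≤ ψ * ψ := by gcongr
            _ = ψ ^ 2 * 1 := by ring
            _ ≤ ψ ^ 2 * ψ ^ 2 := by
              gcongr
              exact one_le_pow₀ hn1
        have h10 : 4 * n * (S + 4 * C₀) ^ 2 ≤ 4 * n * (S + 4 * C₀) ^ 2 * ψ :=
          le_mul_of_one_le_right (by positivity) hn1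
        rw [hN] at h9
        linarith
      · refine h.not_isLocalMax_log hxy (hψpos x y hx.le) hK0 (le_of_eq ?_) ?_ hmax
        · rw [hT, hK, hS]
          field_simp
          norm_num
        · have : 0 ≤ S / 2 * ‖x - y‖ := by positivity
          linarith
  have hψ0 := hψpos x₀ y₀ hR2
  have hle : u x₀ * v y₀ ≤ barrier N S T K p x₀ y₀ ^ 2 := by
    rw [← Real.log_le_log_iff (mul_pos (h.pos x₀) (h.symm.pos y₀)) (by positivity),
      Real.log_pow, Real.log_mul (h.pos x₀).ne' (h.symm.pos y₀).ne']
    push_cast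
    linarith
  refine hle.trans ?_
  gcongr
  exact barrier_midpoint_le (by positivity)

end ProductBound

section Oscillation

variable {n : ℕ} {u v : EuclideanSpace ℝ (Fin n) → ℝ} {C₀ C₁ L : ℝ}

/-- Gradient bound on a level set of `u - v` on which `v` is locally at most `1`. -/
theorem IsSolution.exists_norm_fderiv_le_of_sub_eq (hn : 1 ≤ n) (h : IsSolution u v)
    (hC₁ : 1 ≤ C₁) (hprod : ∀ x y, ‖x - y‖ ≤ 3 → u x * v y ≤ C₁) :
    ∃ C : ℝ, 0 ≤ C ∧ ∀ y, u y - v y = C₁ → ‖fderiv ℝ u y‖ + ‖fderiv ℝ v y‖ ≤ C := by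
  obtain ⟨c, hc, hharnack⟩ := exists_harnack_constant hn
  set A := c * (C₁ + 1) with hA
  have hA0 : 0 < A := by positivity
  refine ⟨(2 * n * A / (1 / 2) + A * (1 / 2)) + (2 * n * 1 / (1 / 2) + A ^ 2 * (1 / 2)),
    by positivity, fun y hy => ?_⟩
  have huy : C₁ ≤ u y := by linarith [h.symm.pos y]
  have hv {x : EuclideanSpace ℝ (Fin n)} (hx : x ∈ closedBall y 3) : v x ≤ 1 := by
    rw [mem_closedBall, dist_eq_norm, norm_sub_rev] at hx
    have h1 := hprod y x hx
    have h2 := h.symm.pos x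
    by_contra! h3
    nlinarith
  have hlap {x : EuclideanSpace ℝ (Fin n)} (hx : x ∈ closedBall y 3) : lap u x ≤ u x := by
    rw [h.lap_eq]
    exact mul_le_of_le_one_right (h.pos x).le (pow_le_one₀ (h.symm.pos x).le (hv hx))
  have hlap0 (x : EuclideanSpace ℝ (Fin n)) : 0 ≤ lap u x := by
    rw [h.lap_eq]
    exact mul_nonneg (h.pos x).le (sq_nonneg _)
  have hsub : closedBall y (1 / 2) ⊆ closedBall y 3 := closedBall_subset_closedBall (by norm_num)
  have hu {x : EuclideanSpace ℝ (Fin n)} (hx : x ∈ closedBall y (1 / 2)) : u x ≤ A := by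
    refine (hharnack u y h.contDiff_two h.pos (fun x _ => hlap0 x) (fun x hx => hlap hx) x
      hx).trans ?_
    have := hv (mem_closedBall_self (x := y) (by norm_num))
    rw [hA]
    gcongr
    linarith
  refine add_le_add ?_ ?_
  · exact norm_fderiv_le hn h.contDiff_two (by norm_num) hA0
      (fun x hx y _ => by linarith [hu hx, h.pos y]) (fun x _ => hlap0 x)
      (fun x hx => (hlap (hsub hx)).trans (hu hx))
  · refine norm_fderiv_le hn h.symm.contDiff_two (by norm_num) one_pos
      (fun x hx y _ => by linarith [hv (hsub hx), h.symm.pos y]) (fun x _ => ?_) (fun x hx => ?_)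
    · rw [h.symm.lap_eq]
      exact mul_nonneg (h.symm.pos x).le (sq_nonneg _)
    · rw [h.symm.lap_eq]
      have h1 := h.pos x
      have h2 := hu hx
      calc v x * u x ^ 2 ≤ 1 * u x ^ 2 := by
            gcongr
            exact hv (hsub hx)
        _ ≤ A ^ 2 := by
            rw [one_mul]
            gcongr

/-- A difference estimate at all scales, from the two-point function
`u x - max (u y - v y) C₁`. -/
theorem IsSolution.exists_le_max_add (hn : 1 ≤ n) (h : IsSolution u v) (hC₀ : 0 < C₀)
    (hgrowth : ∀ x, u x + v x ≤ C₀ * (1 + ‖x‖)) (hC₁ : 1 ≤ C₁)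
    (hprod : ∀ x y, ‖x - y‖ ≤ 3 → u x * v y ≤ C₁) :
    ∃ S : ℝ, 0 ≤ S ∧ ∀ x y, u x ≤ max (u y - v y) C₁ + C₁ + S * ‖x - y‖ := by
  obtain ⟨C, hC, hgrad⟩ := h.exists_norm_fderiv_le_of_sub_eq hn hC₁ hprod
  set S := 8 * C₀ * (n + 1) + 8 * C₀ + 2 * C + 2 with hS
  have hS0 : 0 ≤ S := by positivity
  refine ⟨S, hS0, fun x₀ y₀ => ?_⟩
  set p := (1 / 2 : ℝ) • (x₀ + y₀) with hp
  obtain ⟨R, hR1, hR2⟩ : ∃ R, 1 + ‖p‖ ≤ R ∧ ‖x₀ - y₀‖ ≤ R := ⟨_, le_max_left _ _, le_max_right _ _⟩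
  have hR : 1 ≤ R := by linarith [norm_nonneg p]
  have hR0 : 0 < R := by linarith
  set T := S / (2 * (2 * R)) with hT
  have hT0 : 0 ≤ T := by positivity
  have hTR : T * R = S / 4 := by rw [hT]; field_simp; norm_num
  set K := 4 * C₀ / R with hK
  have hK0 : 0 < K := by positivity
  have hKR : K * R = 4 * C₀ := by rw [hK]; field_simp
  have hψ {x y : EuclideanSpace ℝ (Fin n)} (hxy : ‖x - y‖ ≤ R) :
      C₁ + S / 2 * ‖x - y‖ + K * ‖(1 / 2 : ℝ) • (x + y) - p‖ ^ 2 ≤ barrier C₁ S T K p x y :=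
    le_barrier (by positivity) hS0 (by linarith)
  have hbdry {x y : EuclideanSpace ℝ (Fin n)} (hx : ‖x - y‖ ≤ R)
      (hq : ‖(1 / 2 : ℝ) • (x + y) - p‖ ≤ R) (hle : 4 * C₀ * R ≤ barrier C₁ S T K p x y) :
      u x - max (u y - v y) C₁ - barrier C₁ S T K p x y ≤ 0 := by
    obtain ⟨m1, -⟩ := mem_closedBall_of_midpoint hx hq (by linarith : R + R / 2 ≤ 3 / 2 * R)
    have h1 := growth_le_of_mem_closedBall hC₀ hgrowth hR1 m1
    linarith [le_max_right (u y - v y) C₁, h.symm.pos x]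
  have hcu := h.contDiff_two.continuous
  have hcv := h.symm.contDiff_two.continuous
  have key : u x₀ - max (u y₀ - v y₀) C₁ - barrier C₁ S T K p x₀ y₀ ≤ 0 := by
    refine le_zero_of_no_interior_max (p := p) (d := R) (ρ := R) (G := fun z =>
      u z.1 - max (u z.2 - v z.2) C₁ - barrier C₁ S T K p z.1 z.2)
      ?_ ?_ ?_ ?_ hR2 (by rw [← hp, sub_self, norm_zero]; exact hR0.le)
    · have := continuous_barrier C₁ S T K p
      exact Continuous.continuousOn (by fun_prop)
    · intro x y hx hq
      refine hbdry hx.le hq ?_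
      have h1 := hψ hx.le
      have h2 : 0 ≤ K * ‖(1 / 2 : ℝ) • (x + y) - p‖ ^ 2 := by positivity
      have h3 : 8 * C₀ / 2 * R ≤ S / 2 * R := by
        gcongr
        have : 0 ≤ 8 * C₀ * (n + 1) := by positivity
        linarith
      rw [hx] at h1
      linarith
    · intro x y hx hq
      refine hbdry hx hq.le ?_
      have h1 := hψ hx
      have h2 : 0 ≤ S / 2 * ‖x - y‖ := by positivity
      have h3 : K * R ^ 2 = 4 * C₀ * R := by rw [sq, ← mul_assoc, hKR]
      rw [hq, h3] at h1
      linarith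
    · intro x y hx hq hpos hmax
      simp only at hpos
      have hxy : x ≠ y := by
        rintro rfl
        have h1 := hψ hx.le
        have h2 : 0 ≤ K * ‖(1 / 2 : ℝ) • (x + x) - p‖ ^ 2 := by positivity
        simp only [sub_self, norm_zero, mul_zero, add_zero] at h1
        have h3 := hprod x x (by simp)
        have h4 := h.pos x
        have h5 := h.symm.pos x
        rcases le_total (v x) C₁ with h6 | h6
        · linarith [le_max_left (u x - v x) C₁]
        · have : u x ≤ C₁ := by nlinarith
          linarith [le_max_right (u x - v x) C₁]
      rcases lt_or_ge C₁ (u y - v y) with hw | hw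
      · have hev : ∀ᶠ z : EuclideanSpace ℝ (Fin n) × EuclideanSpace ℝ (Fin n) in 𝓝 (x, y),
            u z.1 - max (u z.2 - v z.2) C₁ - barrier C₁ S T K p z.1 z.2 =
              u z.1 + (v z.2 - u z.2) - barrier C₁ S T K p z.1 z.2 := by
          have hc : Continuous fun z : EuclideanSpace ℝ (Fin n) × EuclideanSpace ℝ (Fin n) =>
              u z.2 - v z.2 := by fun_prop
          filter_upwards [hc.continuousAt.eventually (lt_mem_nhds hw)] with z hz
          rw [max_eq_left hz.le]
          ring
        have hmax' := hmax.congr hev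
        have h1 := lap_add_lap_le h.contDiff_two (h.symm.contDiff_two.sub h.contDiff_two) hxy hmax'
        rw [lap_sub h.symm.contDiff_two h.contDiff_two, h.lap_eq, h.lap_eq, h.symm.lap_eq] at h1
        have hux := h.pos x
        have huy := h.pos y
        have hvy := h.symm.pos y
        have h2 : 0 ≤ u x * v x ^ 2 := by positivity
        have h3 : 0 < u y * v y * (u y - v y) := mul_pos (mul_pos huy hvy) (by linarith)
        have h4 : K * (n + 1) / 2 ≤ T := by
          have e : K * (n + 1) / 2 = 8 * C₀ * (n + 1) / (2 * (2 * R)) := by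
            rw [hK]
            field_simp
            norm_num
          rw [e, hT]
          gcongr
          linarith
        have h5 : 0 ≤ K * n := by positivity
        linarith
      · obtain ⟨e, he, hxe⟩ := exists_unit_direction hxy
        have hr := norm_pos_iff.2 (sub_ne_zero.2 hxy)
        have hψd := hasDerivAt_barrier (a := C₁) (S := S) (T := T) (K := K) (p := p) he hr hxe 0 e
        have hmove : ∀ᶠ t : ℝ in 𝓝[>] 0,
            max (u (y + t • e) - v (y + t • e)) C₁ ≤ C₁ + (C + 1) * t := by
          rcases hw.lt_or_eq with hw | hw
          · have hc : ContinuousAt (fun t : ℝ => u (y + t • e) - v (y + t • e)) 0 := by fun_prop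
            have := hc.eventually_lt_const (u := C₁) (by simpa using hw)
            filter_upwards [this.filter_mono nhdsWithin_le_nhds, self_mem_nhdsWithin] with t h1 h2
            have : 0 ≤ (C + 1) * t := mul_nonneg (by linarith) (le_of_lt h2)
            exact max_le (by linarith) (by linarith)
          · have hwd := (hasJet_line h.contDiff_two y e).hasDerivAt.sub
              (hasJet_line h.symm.contDiff_two y e).hasDerivAt
            have hlt : fderiv ℝ u y e - fderiv ℝ v y e < C + 1 := by
              have h1 := (fderiv ℝ u y).le_opNorm e
              have h2 := (fderiv ℝ v y).le_opNorm e
              rw [he, mul_one, Real.norm_eq_abs] at h1 h2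
              linarith [hgrad y hw, le_of_abs_le h1, neg_le_of_abs_le h2]
            filter_upwards [hwd.tendsto_slope_zero_right.eventually (gt_mem_nhds hlt),
              self_mem_nhdsWithin] with t h1 h2
            rw [zero_add, smul_eq_mul, inv_mul_lt_iff₀ h2] at h1
            simp only [Pi.sub_apply, zero_smul, add_zero] at h1
            have : 0 ≤ (C + 1) * t := mul_nonneg (by linarith) (le_of_lt h2)
            exact max_le (by linarith) (by linarith)
        have h1 := hψd.fun_neg.le_of_eventually_le (M := C + 1) (by
          filter_upwards [hmove, (hmax.comp_line 0 e).filter_mono nhdsWithin_le_nhds]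
            with t h1 h2
          simp only [zero_smul, smul_zero, add_zero, max_eq_right hw] at h2 ⊢
          linarith)
        rw [zero_sub, inner_neg_right, real_inner_self_eq_norm_sq, he, zero_add] at h1
        have h2 : K * ⟪(1 / 2 : ℝ) • (x + y) - p, e⟫ ≤ 4 * C₀ := by
          rw [← hKR]
          have := real_inner_le_norm ((1 / 2 : ℝ) • (x + y) - p) e
          rw [he, mul_one] at this
          gcongr
          exact this.trans hq.le
        have h3 : T * ‖x - y‖ ≤ S / 4 := by
          rw [← hTR]
          gcongr
        have h4 : 0 < C₀ * (n + 1) := by positivity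
        linarith
  have := barrier_midpoint_le (a := C₁) (S := S) (K := K) (x := x₀) (y := y₀) hT0
  linarith

theorem IsSolution.exists_oscillation_le (hn : 1 ≤ n) (h : IsSolution u v) (hC₀ : 0 < C₀)
    (hgrowth : ∀ x, u x + v x ≤ C₀ * (1 + ‖x‖)) (hC₁ : 1 ≤ C₁)
    (hprod : ∀ x y, ‖x - y‖ ≤ 3 → u x * v y ≤ C₁) :
    ∃ L : ℝ, 0 ≤ L ∧ ∀ x y, ‖x - y‖ ≤ 1 → u x ≤ u y + L := by
  obtain ⟨S, hS, hle⟩ := h.exists_le_max_add hn hC₀ hgrowth hC₁ hprod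
  refine ⟨2 * C₁ + S, by linarith, fun x y hxy => (hle x y).trans ?_⟩
  have h1 : max (u y - v y) C₁ ≤ u y + C₁ :=
    max_le (by linarith [h.symm.pos y]) (by linarith [h.pos y])
  have h2 : S * ‖x - y‖ ≤ S := mul_le_of_le_one_right hS hxy
  linarith

theorem IsSolution.norm_fderiv_le (hn : 1 ≤ n) (h : IsSolution u v) (hC₁ : 1 ≤ C₁) (hL : 0 ≤ L)
    (hprod : ∀ x y, ‖x - y‖ ≤ 3 → u x * v y ≤ C₁)
    (hu : ∀ x y, ‖x - y‖ ≤ 1 → u x ≤ u y + L) (hv : ∀ x y, ‖x - y‖ ≤ 1 → v x ≤ v y + L)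
    (z : EuclideanSpace ℝ (Fin n)) :
    ‖fderiv ℝ u z‖ ≤ (2 * n * C₁ + C₁ * (1 + L) ^ 2) + (2 * n * (2 * L + 1) + C₁ * (1 + L)) := by
  have hlap0 (x : EuclideanSpace ℝ (Fin n)) : 0 ≤ lap u x := by
    rw [h.lap_eq]
    exact mul_nonneg (h.pos x).le (sq_nonneg _)
  have hvz := h.symm.pos z
  rcases le_total 1 (v z) with hz | hz
  · have hd : 1 / v z ≤ 1 := (div_le_one hvz).2 hz
    have hux {x : EuclideanSpace ℝ (Fin n)} (hx : x ∈ closedBall z (1 / v z)) :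
        u x ≤ C₁ / v z := by
      rw [mem_closedBall, dist_eq_norm] at hx
      rw [le_div_iff₀ hvz]
      exact hprod x z (by linarith)
    have := _root_.norm_fderiv_le (p := z) (d := 1 / v z) (A := C₁ / v z)
      (B := C₁ * v z * (1 + L) ^ 2) hn h.contDiff_two (by positivity) (by positivity)
      (fun x hx y _ => by linarith [hux hx, h.pos y]) (fun x _ => hlap0 x) (fun x hx => by
        have h1 := hux hx
        rw [mem_closedBall, dist_eq_norm] at hx
        have h2 : v x ≤ v z * (1 + L) := by nlinarith [hv x z (by linarith)]
        have h3 := h.symm.pos x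
        calc lap u x = u x * v x ^ 2 := h.lap_eq x
          _ ≤ C₁ / v z * (v z * (1 + L)) ^ 2 := by gcongr
          _ = C₁ * v z * (1 + L) ^ 2 := by field_simp)
    have e : 2 * n * (C₁ / v z) / (1 / v z) + C₁ * v z * (1 + L) ^ 2 * (1 / v z) =
        2 * n * C₁ + C₁ * (1 + L) ^ 2 := by field_simp
    rw [e] at this
    refine this.trans (le_add_of_nonneg_right (by positivity))
  · have := _root_.norm_fderiv_le (p := z) (d := 1) (A := 2 * L + 1) (B := C₁ * (1 + L)) hn
      h.contDiff_two one_pos (by positivity)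
      (fun x hx y hy => by
        rw [mem_closedBall, dist_eq_norm] at hx hy
        rw [norm_sub_rev] at hy
        linarith [hu x z hx, hu z y hy]) (fun x _ => hlap0 x) (fun x hx => by
        rw [mem_closedBall, dist_eq_norm] at hx
        have h1 := hv x z hx
        have h2 := h.symm.pos x
        calc lap u x = (u x * v x) * v x := by rw [h.lap_eq]; ring
          _ ≤ C₁ * (1 + L) := by
            gcongr
            · exact hprod x x (by simp)
            · linarith)
    rw [div_one, mul_one] at this
    refine this.trans (le_add_of_nonneg_left (by positivity))

end Oscillation

/-- Global Lipschitz bound: an entire solution with linear growth has uniformly bounded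
gradients. -/
theorem global_lipschitz_bound {n : ℕ} (hn : 2 ≤ n)
    (u v : EuclideanSpace ℝ (Fin n) → ℝ) (hsol : IsSolution u v)
    (C₀ : ℝ) (hC₀ : 0 < C₀) (hgrowth : ∀ x, u x + v x ≤ C₀ * (1 + ‖x‖)) :
    ∃ C : ℝ, 0 < C ∧ ∀ x : EuclideanSpace ℝ (Fin n),
      ‖gradient u x‖ + ‖gradient v x‖ ≤ C := by
  have hn1 : 1 ≤ n := by omega
  obtain ⟨N, S, hN, hS, hNS⟩ := hsol.exists_mul_le hC₀ hgrowth
  set C₁ := (N + S * 3) ^ 2 with hC₁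
  have hC₁1 : 1 ≤ C₁ := one_le_pow₀ (by linarith)
  have hprod (x y : EuclideanSpace ℝ (Fin n)) (hxy : ‖x - y‖ ≤ 3) : u x * v y ≤ C₁ :=
    (hNS x y).trans (by rw [hC₁]; gcongr)
  have hprod' (x y : EuclideanSpace ℝ (Fin n)) (hxy : ‖x - y‖ ≤ 3) : v x * u y ≤ C₁ := by
    rw [mul_comm]
    exact hprod y x (by rwa [norm_sub_rev])
  have hgrowth' (x : EuclideanSpace ℝ (Fin n)) : v x + u x ≤ C₀ * (1 + ‖x‖) := by
    rw [add_comm]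
    exact hgrowth x
  obtain ⟨L₁, hL₁, hu⟩ := hsol.exists_oscillation_le hn1 hC₀ hgrowth hC₁1 hprod
  obtain ⟨L₂, hL₂, hv⟩ := hsol.symm.exists_oscillation_le hn1 hC₀ hgrowth' hC₁1 hprod'
  set L := max L₁ L₂
  have hL : 0 ≤ L := hL₁.trans (le_max_left _ _)
  have hu' (x y : EuclideanSpace ℝ (Fin n)) (hxy : ‖x - y‖ ≤ 1) : u x ≤ u y + L :=
    (hu x y hxy).trans (by gcongr; exact le_max_left _ _)
  have hv' (x y : EuclideanSpace ℝ (Fin n)) (hxy : ‖x - y‖ ≤ 1) : v x ≤ v y + L :=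
    (hv x y hxy).trans (by gcongr; exact le_max_right _ _)
  set M := (2 * n * C₁ + C₁ * (1 + L) ^ 2) + (2 * n * (2 * L + 1) + C₁ * (1 + L))
  have hM : 0 < M := by positivity
  refine ⟨M + M, by positivity, fun x => ?_⟩
  simp only [gradient, LinearIsometryEquiv.norm_map]
  exact add_le_add (hsol.norm_fderiv_le hn1 hC₁1 hL hprod hu' hv' x)
    (hsol.symm.norm_fderiv_le hn1 hC₁1 hL hprod' hv' hu' x)
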